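/- Let s > 1/2, u ∈ 𝒮'(ℝ^d) a tempered distribution, φ, ψ ∈ Σ_s(ℝ^d) \ {0}, and z₀ ∈ ℝ^{2d} \ {0}. If there exists an open conic set Γ ⊆ ℝ^{2d} \ {0} containing z₀ such that sup_{z ∈ Γ} e^{A|z|^{1/s}} |V_φ u(z)| < ∞ for every A > 0, then there exists an open conic set Γ' ⊆ ℝ^{2d} \ {0} containing z₀ such that sup_{z ∈ Γ'} e^{A|z|^{1/s}} |V_ψ u(z)| < ∞ for every A > 0. Consequently the s-Gelfand–Shilov wave front set WF^s(u) does not depend on the choice of window in Σ_s(ℝ^d) \ {0}. -/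

import Mathlib

open MeasureTheory Filter
open scoped BigOperators ENNReal RealInnerProductSpace

noncomputable section

/-- `ℝ^d` with the Euclidean norm. -/
abbrev Ed (d : ℕ) : Type := EuclideanSpace ℝ (Fin d)

/-- Partial derivative along the `i`-th coordinate direction. -/
def pdGS {d : ℕ} (i : Fin d) (f : Ed d → ℂ) : Ed d → ℂ :=
  fun x => fderiv ℝ f x (EuclideanSpace.single i 1)

/-- Multi-index partial derivative `∂^β`. -/
def mderiv {d : ℕ} (β : Fin d → ℕ) (f : Ed d → ℂ) : Ed d → ℂ :=
  ((List.ofFn fun i : Fin d => (pdGS i)^[β i]).foldr (· ∘ ·) id) f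

/-- Monomial `x^α`. -/
def mpow {d : ℕ} (x : Ed d) (α : Fin d → ℕ) : ℝ := ∏ i, x i ^ α i

/-- Multi-index factorial `α!`. -/
def mfact {d : ℕ} (α : Fin d → ℕ) : ℕ := ∏ i, Nat.factorial (α i)

/-- Multi-index length `|α|`. -/
def mlen {d : ℕ} (α : Fin d → ℕ) : ℕ := ∑ i, α i

/-- The Gelfand–Shilov seminorm `‖f‖_{S_{s,h}}`, valued in `[0,∞]`. -/
def GSnorm {d : ℕ} (s h : ℝ) (f : Ed d → ℂ) : ℝ≥0∞ :=
  ⨆ (x : Ed d) (α : Fin d → ℕ) (β : Fin d → ℕ),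
    ENNReal.ofReal (|mpow x α| * ‖mderiv β f x‖ /
      (h ^ (mlen α + mlen β) * ((mfact α : ℝ) * (mfact β : ℝ)) ^ s))

/-- The Gelfand–Shilov space `Σ_s(ℝ^d)`: smooth functions all of whose
`S_{s,h}` seminorms are finite. -/
def SigmaGS (s : ℝ) (d : ℕ) : Set (Ed d → ℂ) :=
  {f | ContDiff ℝ ((⊤ : ℕ∞) : WithTop ℕ∞) f ∧ ∀ h : ℝ, 0 < h → GSnorm s h f < ⊤}

/-- The seminorm `|f|_A`, valued in `[0,∞]`. -/
def GSnormA {d : ℕ} (s A : ℝ) (f : Ed d → ℂ) : ℝ≥0∞ :=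
  ⨆ (x : Ed d) (β : Fin d → ℕ),
    ENNReal.ofReal (A ^ mlen β * Real.exp (A * ‖x‖ ^ (1/s)) * ‖mderiv β f x‖ /
      (mfact β : ℝ) ^ s)

/-- The Fourier transform `f̂(ξ) = ∫ f(x) e^{-i⟨x,ξ⟩} dx`. -/
def FTgs {d : ℕ} (f : Ed d → ℂ) (ξ : Ed d) : ℂ :=
  ∫ x : Ed d, f x * Complex.exp (-(Complex.I * (⟪x, ξ⟫ : ℝ)))

/-- The short-time Fourier transform of a function `f` with window `φ`. -/
def STFTgs {d : ℕ} (φ f : Ed d → ℂ) (z : Ed d × Ed d) : ℂ :=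
  ∫ y : Ed d, f y * (starRingEnd ℂ) (φ (y - z.1)) * Complex.exp (-(Complex.I * (⟪y, z.2⟫ : ℝ)))

/-- Euclidean norm of a phase-space point `(x,ξ) ∈ ℝ^{2d}`. -/
def pnorm {d : ℕ} (z : Ed d × Ed d) : ℝ := Real.sqrt (‖z.1‖ ^ 2 + ‖z.2‖ ^ 2)

/-- A conic subset: invariant under multiplication by positive reals. -/
def IsConic {V : Type*} [SMul ℝ V] (Γ : Set V) : Prop :=
  ∀ t : ℝ, 0 < t → ∀ z ∈ Γ, t • z ∈ Γ

/-- Tempered distributions on `ℝ^d`. -/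
abbrev TD (d : ℕ) : Type := SchwartzMap (Ed d) ℂ →L[ℂ] ℂ

/-- `W` is the short-time Fourier transform `V_φ u` of the tempered distribution `u`
with respect to the window `φ`. -/
def IsSTFT {d : ℕ} (u : TD d) (φ : Ed d → ℂ) (W : Ed d × Ed d → ℂ) : Prop :=
  ∀ (x ξ : Ed d) (g : SchwartzMap (Ed d) ℂ),
    (∀ y : Ed d, g y = (starRingEnd ℂ) (φ (y - x)) * Complex.exp (-(Complex.I * (⟪y, ξ⟫ : ℝ)))) →
    W (x, ξ) = u g

/-- The `s`-Gelfand–Shilov wave front set of a distribution whose short-time Fourier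
transform is `W`: the set of nonzero phase-space points having no open conic
neighbourhood on which `e^{A|z|^{1/s}} |W(z)|` is bounded for every `A > 0`. -/
def WFs {d : ℕ} (s : ℝ) (W : Ed d × Ed d → ℂ) : Set (Ed d × Ed d) :=
  {z₀ | z₀ ≠ 0 ∧ ¬ ∃ Γ : Set (Ed d × Ed d), IsOpen Γ ∧ IsConic Γ ∧
    (0 : Ed d × Ed d) ∉ Γ ∧ z₀ ∈ Γ ∧
    ∀ A : ℝ, 0 < A → ∃ C : ℝ, ∀ z ∈ Γ, Real.exp (A * pnorm z ^ (1/s)) * ‖W z‖ ≤ C}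

/-- The real quadratic form `⟨Bx, x⟩` of a matrix `B`. -/
def qf {d : ℕ} (B : Matrix (Fin d) (Fin d) ℝ) (x : Ed d) : ℝ :=
  ∑ i, (∑ j, B i j * x j) * x i

/-- Tempered distributions on `ℝ^m × ℝ^n`. -/
abbrev TD2 (m n : ℕ) : Type := SchwartzMap (Ed m × Ed n) ℂ →L[ℂ] ℂ

/-- Short-time Fourier transform of a tempered distribution on `ℝ^m × ℝ^n`. -/
def IsSTFT2 {m n : ℕ} (w : TD2 m n) (Φ : Ed m × Ed n → ℂ)
    (W : (Ed m × Ed n) × (Ed m × Ed n) → ℂ) : Prop :=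
  ∀ (x ξ : Ed m × Ed n) (g : SchwartzMap (Ed m × Ed n) ℂ),
    (∀ y : Ed m × Ed n, g y = (starRingEnd ℂ) (Φ (y - x)) *
      Complex.exp (-(Complex.I * ((⟪y.1, ξ.1⟫ + ⟪y.2, ξ.2⟫ : ℝ))))) →
    W (x, ξ) = w g

/-- Euclidean norm of a phase-space point of `T^*(ℝ^m × ℝ^n)`. -/
def pnorm2 {m n : ℕ} (z : (Ed m × Ed n) × (Ed m × Ed n)) : ℝ :=
  Real.sqrt (‖z.1.1‖ ^ 2 + ‖z.1.2‖ ^ 2 + ‖z.2.1‖ ^ 2 + ‖z.2.2‖ ^ 2)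

/-- The `s`-Gelfand–Shilov wave front set on `ℝ^m × ℝ^n`. -/
def WFs2 {m n : ℕ} (s : ℝ) (W : (Ed m × Ed n) × (Ed m × Ed n) → ℂ) :
    Set ((Ed m × Ed n) × (Ed m × Ed n)) :=
  {z₀ | z₀ ≠ 0 ∧ ¬ ∃ Γ : Set ((Ed m × Ed n) × (Ed m × Ed n)), IsOpen Γ ∧ IsConic Γ ∧
    (0 : (Ed m × Ed n) × (Ed m × Ed n)) ∉ Γ ∧ z₀ ∈ Γ ∧
    ∀ A : ℝ, 0 < A → ∃ C : ℝ, ∀ z ∈ Γ, Real.exp (A * pnorm2 z ^ (1/s)) * ‖W z‖ ≤ C}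

section ChangeOfWindow

open scoped Topology BoundedContinuousFunction SchwartzMap NNReal

/-- A linear functional dominated by the norm of a linear map into a normed space factors through
that map via a continuous functional. -/
theorem exists_continuousLinearMap_factor {V B : Type*} [AddCommGroup V] [Module ℂ V]
    [NormedAddCommGroup B] [NormedSpace ℂ B] (J : V →ₗ[ℂ] B) (u : V →ₗ[ℂ] ℂ) (C : ℝ)
    (h : ∀ f, ‖u f‖ ≤ C * ‖J f‖) : ∃ U : B →L[ℂ] ℂ, ∀ f, U (J f) = u f := by
  have hker : LinearMap.ker J ≤ LinearMap.ker u := by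
    intro f hf
    have h1 := h f
    rw [LinearMap.mem_ker] at hf ⊢
    rw [hf] at h1
    simpa using h1
  let v : LinearMap.range J →ₗ[ℂ] ℂ :=
    ((LinearMap.ker J).liftQ u hker) ∘ₗ J.quotKerEquivRange.symm.toLinearMap
  have hv : ∀ f, v ⟨J f, f, rfl⟩ = u f := by
    intro f
    have h2 : J.quotKerEquivRange.symm ⟨J f, f, rfl⟩ = (LinearMap.ker J).mkQ f := by
      rw [LinearEquiv.symm_apply_eq]
      rfl
    simp only [v, LinearMap.comp_apply, LinearEquiv.coe_coe, h2]
    simp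
  obtain ⟨U, hU, -⟩ := exists_extension_norm_eq (LinearMap.range J) (v.mkContinuous C (by
    rintro ⟨_, f, rfl⟩
    rw [hv]
    exact h f))
  exact ⟨U, fun f => by rw [← hv f]; exact hU ⟨J f, f, rfl⟩⟩

/-- The weighted derivative `y ↦ ‖y‖^k D^n f(y)` of a Schwartz function as a bounded continuous
function. -/
def weightedJet {E : Type*} [NormedAddCommGroup E] [NormedSpace ℝ E] (k n : ℕ) :
    𝓢(E, ℂ) →ₗ[ℂ] (E →ᵇ E [×n]→L[ℝ] ℂ) where
  toFun f := BoundedContinuousFunction.ofNormedAddCommGroup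
    (fun y => (‖y‖ ^ k : ℝ) • iteratedFDeriv ℝ n f y)
    ((continuous_norm.pow k).smul ((f.smooth ⊤).continuous_iteratedFDeriv (mod_cast le_top)))
    (SchwartzMap.seminorm ℂ k n f) (fun y => by
      rw [norm_smul, Real.norm_of_nonneg (by positivity)]
      exact SchwartzMap.le_seminorm ℂ k n f y)
  map_add' f g := by
    ext1 y
    have : iteratedFDeriv ℝ n (f + g : 𝓢(E, ℂ)) y
        = iteratedFDeriv ℝ n f y + iteratedFDeriv ℝ n g y :=
      iteratedFDeriv_add_apply ((f.smooth n).contDiffAt) ((g.smooth n).contDiffAt)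
    change (‖y‖ ^ k : ℝ) • iteratedFDeriv ℝ n (f + g : 𝓢(E, ℂ)) y = _
    rw [this, smul_add]
    rfl
  map_smul' c f := by
    ext1 y
    have : iteratedFDeriv ℝ n (c • f : 𝓢(E, ℂ)) y = c • iteratedFDeriv ℝ n f y :=
      iteratedFDeriv_const_smul_apply ((f.smooth n).contDiffAt)
    change (‖y‖ ^ k : ℝ) • iteratedFDeriv ℝ n (c • f : 𝓢(E, ℂ)) y = _
    rw [this, smul_comm]
    rfl

theorem weightedJet_apply {E : Type*} [NormedAddCommGroup E] [NormedSpace ℝ E] (k n : ℕ)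
    (f : 𝓢(E, ℂ)) (y : E) :
    weightedJet k n f y = (‖y‖ ^ k : ℝ) • iteratedFDeriv ℝ n f y := rfl

theorem seminorm_le_norm_weightedJet {E : Type*} [NormedAddCommGroup E] [NormedSpace ℝ E]
    (k n : ℕ) (f : 𝓢(E, ℂ)) : SchwartzMap.seminorm ℂ k n f ≤ ‖weightedJet k n f‖ := by
  refine SchwartzMap.seminorm_le_bound ℂ k n f (norm_nonneg (weightedJet k n f)) fun y => ?_
  have := (weightedJet k n f).norm_coe_le_norm y
  rwa [weightedJet_apply, norm_smul, Real.norm_of_nonneg (by positivity)] at this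

/-- A jointly continuous family of bounded functions with locally uniform decay at infinity is
continuous for the uniform norm. -/
theorem continuous_boundedContinuousFunction_of_decay {W E V : Type*} [TopologicalSpace W]
    [NormedAddCommGroup E] [ProperSpace E] [NormedAddCommGroup V]
    (F : W → E →ᵇ V) (hF : Continuous fun p : W × E => F p.1 p.2)
    (b : W → ℝ) (hb : Continuous b) (hdecay : ∀ w y, ‖y‖ * ‖F w y‖ ≤ b w) : Continuous F := by
  rw [continuous_iff_continuousAt]
  intro w₀
  rw [ContinuousAt, Metric.tendsto_nhds]
  intro ε hε
  have hb0 : ∀ w, 0 ≤ b w := fun w => le_trans (by positivity) (hdecay w 0)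
  set M := b w₀ + 1 with hM
  have hMpos : 0 < M := by linarith [hb0 w₀]
  set R := 4 * M / ε with hR
  have hRpos : 0 < R := by positivity
  have hbM : ∀ᶠ w in 𝓝 w₀, b w < M := hb.continuousAt.eventually_lt_const (by linarith)
  have hK : ∀ᶠ w in 𝓝 w₀, ∀ y ∈ Metric.closedBall (0 : E) R, dist (F w y) (F w₀ y) < ε / 2 := by
    refine (isCompact_closedBall (0 : E) R).eventually_forall_of_forall_eventually fun y _ => ?_
    have hcont : Continuous fun z : W × E => dist (F z.1 z.2) (F w₀ z.2) :=
      hF.dist ((F w₀).continuous.comp continuous_snd)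
    refine hcont.continuousAt.eventually_lt_const ?_
    simpa using half_pos hε
  have hout : ∀ w, b w < M → ∀ y, R < ‖y‖ → ‖F w y‖ ≤ ε / 4 := by
    intro w hw y hy
    have h1 : R * ‖F w y‖ ≤ M :=
      (mul_le_mul_of_nonneg_right hy.le (norm_nonneg _)).trans ((hdecay w y).trans hw.le)
    have h2 : ‖F w y‖ ≤ M / R := by rw [le_div_iff₀ hRpos]; linarith
    have h3 : M / R = ε / 4 := by rw [hR]; field_simp
    linarith
  filter_upwards [hbM, hK] with w hw hwK
  refine lt_of_le_of_lt ((BoundedContinuousFunction.dist_le (half_pos hε).le).2 fun y => ?_)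
    (half_lt_self hε)
  by_cases hy : ‖y‖ ≤ R
  · exact (hwK y (by simpa using hy)).le
  · push Not at hy
    have h1 := hout w hw y hy
    have h2 := hout w₀ (by linarith) y hy
    rw [dist_eq_norm]
    linarith [norm_sub_le (F w y) (F w₀ y)]

set_option maxSynthPendingDepth 3 in
/-- Differentiation under the integral sign to all orders. -/
theorem iteratedFDeriv_integral_eq {W E : Type*} [TopologicalSpace W] [MeasurableSpace W]
    [OpensMeasurableSpace W] [SecondCountableTopology W] {μ : Measure W}
    [NormedAddCommGroup E] [NormedSpace ℝ E] [FiniteDimensional ℝ E]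
    (F : W → 𝓢(E, ℂ)) (hc : ∀ n, Continuous fun p : W × E => iteratedFDeriv ℝ n (F p.1) p.2)
    (hb : ∀ n, ∃ b : W → ℝ, Integrable b μ ∧ ∀ w y, ‖iteratedFDeriv ℝ n (F w) y‖ ≤ b w)
    (n : ℕ) (y : E) :
    iteratedFDeriv ℝ n (fun y => ∫ w, F w y ∂μ) y = ∫ w, iteratedFDeriv ℝ n (F w) y ∂μ := by
  have hcy : ∀ n y, Continuous fun w => iteratedFDeriv ℝ n (F w) y := fun n y =>
    (hc n).comp (Continuous.prodMk_left y)
  induction n generalizing y with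
  | zero =>
    ext m
    have hint : Integrable (fun w => iteratedFDeriv ℝ 0 (F w) y) μ := by
      obtain ⟨b, hb1, hb2⟩ := hb 0
      exact hb1.mono' (hcy 0 y).aestronglyMeasurable (ae_of_all _ fun w => hb2 w y)
    rw [ContinuousMultilinearMap.integral_apply hint]
    simp
  | succ n ih =>
    have ih' : iteratedFDeriv ℝ n (fun y => ∫ w, F w y ∂μ)
        = fun y => ∫ w, iteratedFDeriv ℝ n (F w) y ∂μ := funext ih
    obtain ⟨b, hb1, hb2⟩ := hb (n + 1)
    have hfd : ∀ w y, fderiv ℝ (iteratedFDeriv ℝ n (F w)) y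
        = continuousMultilinearCurryLeftEquiv ℝ (fun _ : Fin (n + 1) => E) ℂ
          (iteratedFDeriv ℝ (n + 1) (F w) y) := by
      intro w y
      rw [iteratedFDeriv_succ_eq_comp_left]
      simp
    have hmeas : Continuous fun w => fderiv ℝ (iteratedFDeriv ℝ n (F w)) y := by
      simp only [hfd]
      exact (LinearIsometryEquiv.continuous _).comp (hcy (n + 1) y)
    have hd := hasFDerivAt_integral_of_dominated_of_fderiv_le (μ := μ) (𝕜 := ℝ) (x₀ := y)
      (F := fun y w => iteratedFDeriv ℝ n (F w) y)
      (F' := fun y w => fderiv ℝ (iteratedFDeriv ℝ n (F w)) y) (bound := b) (s := Set.univ)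
      univ_mem (Eventually.of_forall fun y => (hcy n y).aestronglyMeasurable)
      (by
        obtain ⟨b', hb1', hb2'⟩ := hb n
        exact hb1'.mono' (hcy n y).aestronglyMeasurable (ae_of_all _ fun w => hb2' w y))
      hmeas.aestronglyMeasurable
      (ae_of_all _ fun w y _ => by
        rw [hfd, LinearIsometryEquiv.norm_map]
        exact hb2 w y)
      hb1
      (ae_of_all _ fun w y _ => by
        refine DifferentiableAt.hasFDerivAt ?_
        exact (((F w).smooth ⊤).differentiable_iteratedFDeriv
          (mod_cast WithTop.coe_lt_top n)).differentiableAt)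
    rw [iteratedFDeriv_succ_eq_comp_left, Function.comp_apply, ih', hd.fderiv]
    simp only [hfd]
    rw [LinearIsometryEquiv.symm_apply_eq]
    exact (continuousMultilinearCurryLeftEquiv ℝ (fun _ : Fin (n + 1) => E) ℂ
      ).toContinuousLinearEquiv.integral_comp_comm _

set_option maxSynthPendingDepth 3 in
/-- A tempered distribution commutes with absolutely convergent integrals of Schwartz functions. -/
theorem temperedDistribution_integral_eq {W E : Type*} [TopologicalSpace W] [MeasurableSpace W]
    [OpensMeasurableSpace W] [SecondCountableTopology W] {μ : Measure W}
    [NormedAddCommGroup E] [NormedSpace ℝ E] [FiniteDimensional ℝ E]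
    (F : W → 𝓢(E, ℂ)) (hc : ∀ n, Continuous fun p : W × E => iteratedFDeriv ℝ n (F p.1) p.2)
    (hb : ∀ k n, ∃ b : W → ℝ, Continuous b ∧ Integrable b μ ∧
      ∀ w y, ‖y‖ ^ k * ‖iteratedFDeriv ℝ n (F w) y‖ ≤ b w)
    (G : 𝓢(E, ℂ)) (hG : ∀ y, G y = ∫ w, F w y ∂μ) (u : 𝓢(E, ℂ) →L[ℂ] ℂ) :
    u G = ∫ w, u (F w) ∂μ := by
  have : ProperSpace E := FiniteDimensional.proper ℝ E
  obtain ⟨S, C, -, hS⟩ := Seminorm.bound_of_continuous (schwartz_withSeminorms ℂ E ℂ)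
    ((normSeminorm ℂ ℂ).comp u.toLinearMap) (by
      exact continuous_norm.comp u.continuous)
  let J : 𝓢(E, ℂ) →ₗ[ℂ] ((p : S) → (E →ᵇ E [×p.1.2]→L[ℝ] ℂ)) :=
    LinearMap.pi fun p => weightedJet p.1.1 p.1.2
  have hJ : ∀ f, ‖u f‖ ≤ C * ‖J f‖ := by
    intro f
    refine (hS f).trans ?_
    rw [smul_apply, NNReal.smul_def, smul_eq_mul]
    refine mul_le_mul_of_nonneg_left ?_ C.2
    refine Seminorm.finset_sup_apply_le (norm_nonneg _) fun p hp => ?_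
    exact (seminorm_le_norm_weightedJet p.1 p.2 f).trans (norm_le_pi_norm (J f) ⟨p, hp⟩)
  obtain ⟨U, hU⟩ := exists_continuousLinearMap_factor J (u : 𝓢(E, ℂ) →ₗ[ℂ] ℂ) C fun f => hJ f
  have hJF : Continuous fun w => J (F w) := by
    refine continuous_pi fun p => ?_
    obtain ⟨b, hb1, -, hb2⟩ := hb (p.1.1 + 1) p.1.2
    refine continuous_boundedContinuousFunction_of_decay _ ?_ b hb1 fun w y => ?_
    · change Continuous fun q : W × E => (‖q.2‖ ^ p.1.1 : ℝ) • iteratedFDeriv ℝ p.1.2 (F q.1) q.2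
      exact (continuous_snd.norm.pow _).smul (hc _)
    · change ‖y‖ * ‖(‖y‖ ^ p.1.1 : ℝ) • iteratedFDeriv ℝ p.1.2 (F w) y‖ ≤ b w
      rw [norm_smul, Real.norm_of_nonneg (by positivity), ← mul_assoc, ← pow_succ']
      exact hb2 w y
  have hJint : Integrable (fun w => J (F w)) μ := by
    choose b hb1 hb2 hb3 using fun p : ℕ × ℕ => hb p.1 p.2
    have hsum : Integrable (fun w => ∑ p : S, b p.1 w) μ :=
      integrable_finsetSum _ fun p _ => hb2 p.1
    have hb0 : ∀ p w, 0 ≤ b p w := fun p w => le_trans (by positivity) (hb3 p w 0)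
    have : SecondCountableTopologyEither W ((p : S) → (E →ᵇ E [×p.1.2]→L[ℝ] ℂ)) :=
      secondCountableTopologyEither_of_left W _
    refine hsum.mono' hJF.aestronglyMeasurable (ae_of_all _ fun w => ?_)
    refine (pi_norm_le_iff_of_nonneg (Finset.sum_nonneg fun p _ => hb0 p.1 w)).2 fun p => ?_
    refine le_trans ?_ (Finset.single_le_sum (fun p _ => hb0 p.1 w) (Finset.mem_univ p))
    refine (BoundedContinuousFunction.norm_le (hb0 _ _)).2 fun y => ?_
    change ‖(‖y‖ ^ p.1.1 : ℝ) • iteratedFDeriv ℝ p.1.2 (F w) y‖ ≤ _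
    rw [norm_smul, Real.norm_of_nonneg (by positivity)]
    exact hb3 p.1 w y
  have hJG : J G = ∫ w, J (F w) ∂μ := by
    funext p
    ext1 y
    have hev := ((BoundedContinuousFunction.evalCLM ℝ y).comp
      (ContinuousLinearMap.proj (R := ℝ) (φ := fun p : S => (E →ᵇ E [×p.1.2]→L[ℝ] ℂ)) p)
        ).integral_comp_comm hJint
    change (‖y‖ ^ p.1.1 : ℝ) • iteratedFDeriv ℝ p.1.2 G y = _
    have hG' : (G : E → ℂ) = fun y => ∫ w, F w y ∂μ := funext hG
    refine Eq.trans ?_ hev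
    change _ = ∫ w, (‖y‖ ^ p.1.1 : ℝ) • iteratedFDeriv ℝ p.1.2 (F w) y ∂μ
    rw [integral_smul, hG', iteratedFDeriv_integral_eq F hc]
    intro n
    obtain ⟨b, -, hb2, hb3⟩ := hb 0 n
    exact ⟨b, hb2, fun w y => by simpa using hb3 w y⟩
  have hfin := U.integral_comp_comm hJint
  rw [← hJG, hU] at hfin
  simp only [hU] at hfin
  exact hfin.symm

theorem contDiff_pdGS {d : ℕ} (i : Fin d) {f : Ed d → ℂ}
    (hf : ContDiff ℝ ((⊤ : ℕ∞) : WithTop ℕ∞) f) :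
    ContDiff ℝ ((⊤ : ℕ∞) : WithTop ℕ∞) (pdGS i f) :=
  (hf.fderiv_right (m := ((⊤ : ℕ∞) : WithTop ℕ∞)) (by simp)).clm_apply contDiff_const

theorem contDiff_pdGS_iterate {d : ℕ} (i : Fin d) {f : Ed d → ℂ}
    (hf : ContDiff ℝ ((⊤ : ℕ∞) : WithTop ℕ∞) f) (n : ℕ) :
    ContDiff ℝ ((⊤ : ℕ∞) : WithTop ℕ∞) ((pdGS i)^[n] f) := by
  induction n with
  | zero => simpa using hf
  | succ n ih =>
    rw [Function.iterate_succ_apply']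
    exact contDiff_pdGS i ih

theorem pdGS_comm {d : ℕ} (i j : Fin d) {f : Ed d → ℂ}
    (hf : ContDiff ℝ ((⊤ : ℕ∞) : WithTop ℕ∞) f) :
    pdGS i (pdGS j f) = pdGS j (pdGS i f) := by
  have hd : Differentiable ℝ (fderiv ℝ f) :=
    (hf.fderiv_right (m := ((⊤ : ℕ∞) : WithTop ℕ∞)) (by simp)).differentiable (by simp)
  have key : ∀ (k l : Fin d) (x : Ed d), pdGS k (pdGS l f) x
      = fderiv ℝ (fderiv ℝ f) x (EuclideanSpace.single k 1) (EuclideanSpace.single l 1) := by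
    intro k l x
    unfold pdGS
    rw [fderiv_clm_apply (hd x) (differentiableAt_const _)]
    simp
  funext x
  rw [key, key]
  exact (hf.contDiffAt.isSymmSndFDerivAt (by
    simp only [minSmoothness_of_isRCLikeNormedField]
    exact WithTop.coe_le_coe.2 le_top)).eq _ _

theorem pdGS_iterate_comm {d : ℕ} (i j : Fin d) {f : Ed d → ℂ}
    (hf : ContDiff ℝ ((⊤ : ℕ∞) : WithTop ℕ∞) f) (n : ℕ) :
    (pdGS j)^[n] (pdGS i f) = pdGS i ((pdGS j)^[n] f) := by
  induction n with
  | zero => rfl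
  | succ n ih =>
    rw [Function.iterate_succ_apply', Function.iterate_succ_apply', ih,
      pdGS_comm i j (contDiff_pdGS_iterate j hf n)]

theorem contDiff_foldr_pdGS {d : ℕ} (β : Fin d → ℕ) {f : Ed d → ℂ}
    (hf : ContDiff ℝ ((⊤ : ℕ∞) : WithTop ℕ∞) f) (l : List (Fin d)) :
    ContDiff ℝ ((⊤ : ℕ∞) : WithTop ℕ∞)
      (((l.map fun j => (pdGS j)^[β j]).foldr (· ∘ ·) id) f) := by
  induction l with
  | nil => simpa using hf
  | cons j l ih => exact contDiff_pdGS_iterate j ih (β j)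

theorem foldr_pdGS_add_single {d : ℕ} (β : Fin d → ℕ) (i : Fin d) {f : Ed d → ℂ}
    (hf : ContDiff ℝ ((⊤ : ℕ∞) : WithTop ℕ∞) f) (l : List (Fin d)) (hl : l.Nodup) (hi : i ∈ l) :
    ((l.map fun j => (pdGS j)^[(β + Pi.single i 1 : Fin d → ℕ) j]).foldr (· ∘ ·) id) f
      = pdGS i (((l.map fun j => (pdGS j)^[β j]).foldr (· ∘ ·) id) f) := by
  induction l with
  | nil => simp at hi
  | cons j l ih =>
    rw [List.nodup_cons] at hl
    simp only [List.map_cons, List.foldr_cons, Function.comp_apply]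
    by_cases hij : i = j
    · subst hij
      have hmap : (l.map fun j => (pdGS j)^[(β + Pi.single i 1 : Fin d → ℕ) j])
          = l.map fun j => (pdGS j)^[β j] := by
        refine List.map_congr_left fun k hk => ?_
        have hki : k ≠ i := fun h => hl.1 (h ▸ hk)
        simp [hki]
      rw [hmap, ← Function.iterate_succ_apply' (pdGS i)]
      simp
    · have hil : i ∈ l := by simpa [hij] using hi
      rw [ih hl.2 hil, ← pdGS_iterate_comm i j (contDiff_foldr_pdGS β hf l)]
      simp [Ne.symm hij]

theorem mderiv_add_single {d : ℕ} (β : Fin d → ℕ) (i : Fin d) {f : Ed d → ℂ}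
    (hf : ContDiff ℝ ((⊤ : ℕ∞) : WithTop ℕ∞) f) :
    mderiv (β + Pi.single i 1) f = pdGS i (mderiv β f) := by
  simp only [mderiv, List.ofFn_eq_map]
  exact foldr_pdGS_add_single β i hf _ (List.nodup_finRange d) (List.mem_finRange i)

theorem mderiv_zero {d : ℕ} (f : Ed d → ℂ) : mderiv 0 f = f := by
  simp only [mderiv, List.ofFn_eq_map]
  induction List.finRange d with
  | nil => rfl
  | cons j l ih => simpa using ih

theorem mderiv_single {d : ℕ} (j : Fin d) (m : ℕ) {f : Ed d → ℂ}
    (hf : ContDiff ℝ ((⊤ : ℕ∞) : WithTop ℕ∞) f) :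
    mderiv (Pi.single j m) f = (pdGS j)^[m] f := by
  induction m with
  | zero => simp [mderiv_zero]
  | succ m ih =>
    rw [Pi.single_add, mderiv_add_single _ _ hf, ih, Function.iterate_succ_apply']

theorem exists_mderiv_eq_iteratedFDeriv_single {d : ℕ} {f : Ed d → ℂ}
    (hf : ContDiff ℝ ((⊤ : ℕ∞) : WithTop ℕ∞) f) (n : ℕ) (v : Fin n → Fin d) :
    ∃ β : Fin d → ℕ, ∀ x, iteratedFDeriv ℝ n f x (fun k => EuclideanSpace.single (v k) 1)
      = mderiv β f x := by
  induction n with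
  | zero => exact ⟨0, fun x => by simp [mderiv_zero]⟩
  | succ n ih =>
    obtain ⟨β, hβ⟩ := ih (Fin.tail v)
    refine ⟨β + Pi.single (v 0) 1, fun x => ?_⟩
    have hd : DifferentiableAt ℝ (iteratedFDeriv ℝ n f) x :=
      (hf.differentiable_iteratedFDeriv (WithTop.coe_lt_coe.2 (WithTop.coe_lt_top n))) x
    rw [hd.iteratedFDeriv_succ_apply_left', mderiv_add_single _ _ hf, pdGS]
    congr 2
    exact funext hβ

theorem eq_sum_smul_single {d : ℕ} (x : Ed d) :
    x = ∑ i, x i • (EuclideanSpace.single i 1 : Ed d) := by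
  ext j
  simp [Finset.sum_apply, Pi.single_apply]

theorem norm_iteratedFDeriv_le_sum_single {d : ℕ} (f : Ed d → ℂ) (n : ℕ) (x : Ed d) :
    ‖iteratedFDeriv ℝ n f x‖ ≤ ∑ v : Fin n → Fin d,
      ‖iteratedFDeriv ℝ n f x (fun k => EuclideanSpace.single (v k) 1)‖ := by
  refine ContinuousMultilinearMap.opNorm_le_bound (Finset.sum_nonneg fun _ _ => norm_nonneg _)
    fun m => ?_
  have hm : m = fun k => ∑ i, (m k) i • (EuclideanSpace.single i 1 : Ed d) := by
    funext k
    exact eq_sum_smul_single (m k)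
  conv_lhs => rw [hm, ContinuousMultilinearMap.map_sum]
  refine (norm_sum_le _ _).trans ?_
  rw [Finset.sum_mul]
  refine Finset.sum_le_sum fun v _ => ?_
  rw [ContinuousMultilinearMap.map_smul_univ, norm_smul, mul_comm, norm_prod]
  refine mul_le_mul_of_nonneg_left ?_ (norm_nonneg _)
  exact Finset.prod_le_prod (fun _ _ => norm_nonneg _) fun k _ => PiLp.norm_apply_le (m k) (v k)

theorem exists_coord_norm_le {d : ℕ} (hd : 0 < d) (x : Ed d) : ∃ i, ‖x‖ ≤ d * |x i| := by
  have : Nonempty (Fin d) := ⟨⟨0, hd⟩⟩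
  obtain ⟨i, -, hi⟩ := Finset.exists_max_image Finset.univ (fun i => |x i|) Finset.univ_nonempty
  refine ⟨i, ?_⟩
  calc ‖x‖ = ‖∑ i, x i • (EuclideanSpace.single i 1 : Ed d)‖ :=
        congrArg norm (eq_sum_smul_single x)
    _ ≤ ∑ j, ‖x j • (EuclideanSpace.single j 1 : Ed d)‖ := norm_sum_le _ _
    _ ≤ ∑ _j : Fin d, |x i| := Finset.sum_le_sum fun j hj => by
        simpa [norm_smul] using hi j hj
    _ = d * |x i| := by simp

theorem mpow_single {d : ℕ} (x : Ed d) (i : Fin d) (k : ℕ) : mpow x (Pi.single i k) = x i ^ k := by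
  unfold mpow
  rw [Finset.prod_eq_single i] <;> simp +contextual

theorem mfact_single {d : ℕ} (i : Fin d) (k : ℕ) : mfact (Pi.single i k) = k.factorial := by
  unfold mfact
  rw [Finset.prod_eq_single i] <;> simp +contextual

theorem mlen_single {d : ℕ} (i : Fin d) (k : ℕ) : mlen (Pi.single i k) = k := by
  simp [mlen]

theorem SigmaGS.exists_bound {d : ℕ} {s : ℝ} {f : Ed d → ℂ} (hf : f ∈ SigmaGS s d) {h : ℝ}
    (hh : 0 < h) : ∃ C : ℝ, 0 ≤ C ∧ ∀ (x : Ed d) (α β : Fin d → ℕ),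
      |mpow x α| * ‖mderiv β f x‖ ≤
        C * (h ^ (mlen α + mlen β) * ((mfact α : ℝ) * (mfact β : ℝ)) ^ s) := by
  refine ⟨(GSnorm s h f).toReal, ENNReal.toReal_nonneg, fun x α β => ?_⟩
  have hpos : ∀ γ : Fin d → ℕ, (0 : ℝ) < mfact γ := fun γ => by
    unfold mfact
    exact_mod_cast Finset.prod_pos fun i _ => Nat.factorial_pos _
  have hden : 0 < h ^ (mlen α + mlen β) * ((mfact α : ℝ) * (mfact β : ℝ)) ^ s :=
    mul_pos (pow_pos hh _) (Real.rpow_pos_of_pos (mul_pos (hpos α) (hpos β)) s)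
  rw [← div_le_iff₀ hden]
  refine (ENNReal.ofReal_le_iff_le_toReal (hf.2 h hh).ne).1 ?_
  unfold GSnorm
  exact le_iSup_of_le x (le_iSup_of_le α (le_iSup_of_le β le_rfl))

/-- A function of the Gelfand–Shilov space as a Schwartz function. -/
theorem SigmaGS.exists_schwartzMap {d : ℕ} (hd : 0 < d) {s : ℝ} {f : Ed d → ℂ}
    (hf : f ∈ SigmaGS s d) : ∃ g : 𝓢(Ed d, ℂ), ∀ x, g x = f x := by
  refine ⟨⟨f, hf.1, fun k n => ?_⟩, fun x => rfl⟩
  choose β hβ using exists_mderiv_eq_iteratedFDeriv_single hf.1 n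
  obtain ⟨C, hC0, hC⟩ := SigmaGS.exists_bound hf one_pos
  refine ⟨∑ v : Fin n → Fin d, d ^ k * (C * (((k.factorial : ℝ) * (mfact (β v) : ℝ)) ^ s)),
    fun x => ?_⟩
  obtain ⟨i, hi⟩ := exists_coord_norm_le hd x
  have hk : ‖x‖ ^ k ≤ d ^ k * |x i| ^ k := by
    rw [← mul_pow]
    exact pow_le_pow_left₀ (norm_nonneg _) hi k
  refine (mul_le_mul_of_nonneg_left (norm_iteratedFDeriv_le_sum_single f n x)
    (by positivity)).trans ?_
  rw [Finset.mul_sum]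
  refine Finset.sum_le_sum fun v _ => ?_
  rw [hβ]
  refine (mul_le_mul_of_nonneg_right hk (norm_nonneg _)).trans ?_
  rw [mul_assoc]
  refine mul_le_mul_of_nonneg_left ?_ (by positivity)
  have := hC x (Pi.single i k) (β v)
  rwa [mpow_single, mfact_single, abs_pow, one_pow, one_mul] at this

theorem SigmaGS.exists_coord_bound {d : ℕ} {s : ℝ} {f : Ed d → ℂ} (hf : f ∈ SigmaGS s d) {h : ℝ}
    (hh : 0 < h) : ∃ C : ℝ, 0 ≤ C ∧ ∀ (x : Ed d) (i j : Fin d) (n m : ℕ),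
      |x i| ^ n * ‖(pdGS j)^[m] f x‖ ≤
        C * (h ^ (n + m) * ((n.factorial : ℝ) * (m.factorial : ℝ)) ^ s) := by
  obtain ⟨C, hC0, hC⟩ := SigmaGS.exists_bound hf hh
  refine ⟨C, hC0, fun x i j n m => ?_⟩
  have := hC x (Pi.single i n) (Pi.single j m)
  rwa [mpow_single, mfact_single, mfact_single, mlen_single, mlen_single, mderiv_single _ _ hf.1,
    abs_pow] at this

/-- Factorial moment bounds of Gevrey type give stretched exponential decay. -/
theorem le_exp_of_forall_pow_mul_le {s h r M a : ℝ} (hs : 0 < s) (hh : 0 < h) (hr : 0 ≤ r)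
    (hM : 0 ≤ M) (ha : 0 ≤ a) (H : ∀ n : ℕ, r ^ n * a ≤ M * (h ^ n * (n.factorial : ℝ) ^ s)) :
    a ≤ 2 ^ s * M * Real.exp (-(s / 2 * (r / h) ^ (1 / s))) := by
  set t := (r / h) ^ (1 / s) with ht
  have ht0 : 0 ≤ t := by positivity
  have hts : t ^ s = r / h := by
    rw [ht, ← Real.rpow_mul (by positivity), one_div, inv_mul_cancel₀ hs.ne', Real.rpow_one]
  have key : ∀ n : ℕ, (t / 2) ^ n / (n.factorial : ℝ) * a ^ (1 / s) ≤ M ^ (1 / s) * (1 / 2) ^ n := by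
    intro n
    have h1 : (t ^ n) ^ s * a ≤ M * (n.factorial : ℝ) ^ s := by
      rw [← Real.rpow_natCast t n, ← Real.rpow_mul ht0, mul_comm (n : ℝ), Real.rpow_mul ht0, hts,
        Real.rpow_natCast, div_pow, div_mul_eq_mul_div, div_le_iff₀ (by positivity)]
      linarith [H n]
    have h2 := Real.rpow_le_rpow (by positivity) h1 (one_div_pos.2 hs).le
    rw [Real.mul_rpow (by positivity) ha, Real.mul_rpow hM (by positivity),
      ← Real.rpow_mul (by positivity), ← Real.rpow_mul (by positivity), mul_one_div_cancel hs.ne',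
      Real.rpow_one, Real.rpow_one] at h2
    have hf : (0 : ℝ) < n.factorial := by exact_mod_cast n.factorial_pos
    rw [div_mul_eq_mul_div, div_le_iff₀ hf, div_pow, one_div_pow]
    have h2n : (0 : ℝ) < 2 ^ n := by positivity
    calc t ^ n / 2 ^ n * a ^ (1 / s) = (t ^ n * a ^ (1 / s)) * (1 / 2 ^ n) := by ring
      _ ≤ (M ^ (1 / s) * n.factorial) * (1 / 2 ^ n) := by gcongr
      _ = _ := by ring
  have hexp : HasSum (fun n : ℕ => (t / 2) ^ n / (n.factorial : ℝ) * a ^ (1 / s))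
      (Real.exp (t / 2) * a ^ (1 / s)) := by
    rw [Real.exp_eq_exp_ℝ]
    exact (NormedSpace.expSeries_div_hasSum_exp (t / 2)).mul_right _
  have hsum := hasSum_le key hexp (hasSum_geometric_two.mul_left (M ^ (1 / s)))
  have h3 := Real.rpow_le_rpow (by positivity) hsum hs.le
  rw [Real.mul_rpow (by positivity) (by positivity), Real.mul_rpow (by positivity) (by positivity),
    ← Real.rpow_mul ha, ← Real.rpow_mul hM, one_div_mul_cancel hs.ne', Real.rpow_one,
    Real.rpow_one, ← Real.exp_mul] at h3
  rw [Real.exp_neg, ← div_eq_mul_inv, le_div_iff₀ (Real.exp_pos _)]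
  have : t / 2 * s = s / 2 * t := by ring
  rw [this] at h3
  linarith

theorem exists_scale_coord {d : ℕ} (hd : 0 < d) {s A : ℝ} (hs : 0 < s) (hA : 0 < A) :
    ∃ h₀ : ℝ, 0 < h₀ ∧ ∀ h, 0 < h → h ≤ h₀ → ∀ x : Ed d, ∃ i,
      A * ‖x‖ ^ (1 / s) ≤ s / 2 * (|x i| / h) ^ (1 / s) := by
  set c := (2 * A / s) ^ s with hc
  have hcpos : 0 < c := by positivity
  have hd' : (0 : ℝ) < d := by exact_mod_cast hd
  refine ⟨1 / (d * c), by positivity, fun h hh hle x => ?_⟩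
  obtain ⟨i, hi⟩ := exists_coord_norm_le hd x
  refine ⟨i, ?_⟩
  have h1 : c * ‖x‖ ≤ |x i| / h := by
    rw [le_div_iff₀ hh]
    have h2 : d * c * h ≤ 1 := by
      rw [le_div_iff₀ (by positivity)] at hle
      linarith
    calc c * ‖x‖ * h ≤ c * (d * |x i|) * h := by gcongr
      _ = (d * c * h) * |x i| := by ring
      _ ≤ 1 * |x i| := by gcongr
      _ = |x i| := one_mul _
  have h3 : 2 * A / s * ‖x‖ ^ (1 / s) ≤ (|x i| / h) ^ (1 / s) := by
    have h4 := Real.rpow_le_rpow (by positivity) h1 (one_div_pos.2 hs).le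
    rwa [Real.mul_rpow hcpos.le (norm_nonneg _), hc, ← Real.rpow_mul (by positivity),
      mul_one_div_cancel hs.ne', Real.rpow_one] at h4
  calc A * ‖x‖ ^ (1 / s) = s / 2 * (2 * A / s * ‖x‖ ^ (1 / s)) := by field_simp
    _ ≤ _ := by gcongr

theorem SigmaGS.exists_exp_bound {d : ℕ} (hd : 0 < d) {s : ℝ} (hs : 0 < s) {f : Ed d → ℂ}
    (hf : f ∈ SigmaGS s d) {A h : ℝ} (hA : 0 < A) (hh : 0 < h) :
    ∃ C : ℝ, 0 ≤ C ∧ ∀ (x : Ed d) (j : Fin d) (m : ℕ), ‖(pdGS j)^[m] f x‖ ≤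
      C * (h ^ m * (m.factorial : ℝ) ^ s) * Real.exp (-(A * ‖x‖ ^ (1 / s))) := by
  obtain ⟨h₀, hh₀, hsc⟩ := exists_scale_coord hd hs hA
  set h' := min h h₀ with hh'
  have hpos : 0 < h' := lt_min hh hh₀
  obtain ⟨C, hC0, hC⟩ := SigmaGS.exists_coord_bound hf hpos
  refine ⟨2 ^ s * C, by positivity, fun x j m => ?_⟩
  obtain ⟨i, hi⟩ := hsc h' hpos (min_le_right _ _) x
  have h1 := le_exp_of_forall_pow_mul_le (M := C * (h' ^ m * (m.factorial : ℝ) ^ s)) hs hpos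
    (abs_nonneg (x i)) (by positivity) (norm_nonneg ((pdGS j)^[m] f x)) fun n => by
      refine (hC x i j n m).trans_eq ?_
      rw [Real.mul_rpow (by positivity) (by positivity), pow_add]
      ring
  refine h1.trans ?_
  have hle : h' ≤ h := min_le_left _ _
  rw [← mul_assoc (2 ^ s) C]
  gcongr

theorem iteratedDeriv_line_eq {d : ℕ} (j : Fin d) {f : Ed d → ℂ}
    (hf : ContDiff ℝ ((⊤ : ℕ∞) : WithTop ℕ∞) f) (n : ℕ) (x : Ed d) (t : ℝ) :
    iteratedDeriv n (fun t : ℝ => f (x + t • EuclideanSpace.single j 1)) t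
      = (pdGS j)^[n] f (x + t • EuclideanSpace.single j 1) := by
  induction n generalizing t with
  | zero => simp
  | succ n ih =>
    rw [iteratedDeriv_succ, Function.iterate_succ_apply', funext ih]
    have h1 : HasDerivAt (fun t : ℝ => x + t • (EuclideanSpace.single j 1 : Ed d))
        (EuclideanSpace.single j 1) t := by
      simpa using ((hasDerivAt_id t).smul_const (EuclideanSpace.single j (1 : ℝ))).const_add x
    have h2 := ((contDiff_pdGS_iterate j hf n).differentiable (by simp)
      (x + t • EuclideanSpace.single j 1)).hasFDerivAt
    exact (h2.comp_hasDerivAt t h1).deriv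

theorem norm_pdGS_iterate_mul_le {d : ℕ} (j : Fin d) {f g : Ed d → ℂ}
    (hf : ContDiff ℝ ((⊤ : ℕ∞) : WithTop ℕ∞) f) (hg : ContDiff ℝ ((⊤ : ℕ∞) : WithTop ℕ∞) g)
    (n : ℕ) (x : Ed d) :
    ‖(pdGS j)^[n] (fun y => f y * g y) x‖ ≤ ∑ i ∈ Finset.range (n + 1),
      (n.choose i : ℝ) * ‖(pdGS j)^[i] f x‖ * ‖(pdGS j)^[n - i] g x‖ := by
  have hline : ContDiff ℝ ((⊤ : ℕ∞) : WithTop ℕ∞)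
      (fun t : ℝ => x + t • (EuclideanSpace.single j 1 : Ed d)) :=
    contDiff_const.add (contDiff_id.smul contDiff_const)
  have h1 := norm_iteratedFDeriv_mul_le (𝕜 := ℝ) (hf.comp hline) (hg.comp hline) 0 (n := n)
    (WithTop.coe_le_coe.2 le_top)
  simp only [norm_iteratedFDeriv_eq_norm_iteratedDeriv] at h1
  have h2 := iteratedDeriv_line_eq j (hf.mul hg) n x 0
  simp only [Function.comp_def, iteratedDeriv_line_eq j hf, iteratedDeriv_line_eq j hg, h2] at h1
  simpa using h1

theorem pdGS_iterate_conj {d : ℕ} (j : Fin d) (f : Ed d → ℂ) (n : ℕ) :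
    (pdGS j)^[n] (fun y => (starRingEnd ℂ) (f y)) = fun y => (starRingEnd ℂ) ((pdGS j)^[n] f y) := by
  induction n with
  | zero => rfl
  | succ n ih =>
    rw [Function.iterate_succ_apply', Function.iterate_succ_apply', ih]
    funext y
    have h := Complex.conjCLE.comp_fderiv (f := (pdGS j)^[n] f) (x := y)
    have h' : fderiv ℝ (fun y => (starRingEnd ℂ) ((pdGS j)^[n] f y)) y
        = (Complex.conjCLE : ℂ →L[ℝ] ℂ).comp (fderiv ℝ ((pdGS j)^[n] f) y) := h
    simp [pdGS, h']

theorem pdGS_iterate_comp_sub {d : ℕ} (j : Fin d) (f : Ed d → ℂ) (a : Ed d) (n : ℕ) :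
    (pdGS j)^[n] (fun y => f (y - a)) = fun y => (pdGS j)^[n] f (y - a) := by
  induction n with
  | zero => rfl
  | succ n ih =>
    rw [Function.iterate_succ_apply', Function.iterate_succ_apply', ih]
    funext y
    simp only [pdGS]
    rw [fderiv_comp_sub]

theorem FTgs_pdGS {d : ℕ} (j : Fin d) {f : Ed d → ℂ}
    (hf : ContDiff ℝ ((⊤ : ℕ∞) : WithTop ℕ∞) f) (hint : Integrable f)
    (hint' : Integrable (pdGS j f)) (b : Ed d) :
    FTgs (pdGS j f) b = Complex.I * b j * FTgs f b := by
  set e : Ed d → ℂ := fun x => Complex.exp (-(Complex.I * (⟪x, b⟫ : ℝ))) with he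
  have hfd : ∀ x, HasFDerivAt e (e x • -(Complex.I • (Complex.ofRealCLM.comp
      ((innerSL ℝ : Ed d →L[ℝ] Ed d →L[ℝ] ℝ).flip b)))) x := by
    intro x
    have h1 : HasFDerivAt (fun x : Ed d => -(Complex.I * (⟪x, b⟫ : ℝ)))
        (-(Complex.I • (Complex.ofRealCLM.comp
          ((innerSL ℝ : Ed d →L[ℝ] Ed d →L[ℝ] ℝ).flip b)))) x :=
      (((Complex.ofRealCLM.comp
        ((innerSL ℝ : Ed d →L[ℝ] Ed d →L[ℝ] ℝ).flip b)).hasFDerivAt (x := x)).const_mul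
          Complex.I).neg
    exact h1.cexp
  have hed : ∀ x, fderiv ℝ e x (EuclideanSpace.single j 1) = -(Complex.I * b j) * e x := by
    intro x
    rw [(hfd x).fderiv]
    have hb : ((innerSL ℝ : Ed d →L[ℝ] Ed d →L[ℝ] ℝ).flip b) (EuclideanSpace.single j 1) = b j := by
      change ⟪(EuclideanSpace.single j 1 : Ed d), b⟫ = b j
      simp [EuclideanSpace.inner_single_left]
    simp only [smul_apply, neg_apply,
      ContinuousLinearMap.comp_apply, hb, smul_eq_mul, Complex.ofRealCLM_apply]
    ring
  have hnorm : ∀ x, ‖e x‖ = 1 := fun x => by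
    simp [he, Complex.norm_exp]
  have hec : Continuous e := by
    rw [he]
    fun_prop
  have hmul : ∀ {g : Ed d → ℂ}, Integrable g → Integrable fun x => g x * e x := fun hg =>
    hg.mul_bdd (c := 1) hec.aestronglyMeasurable (ae_of_all _ fun x => (hnorm x).le)
  have h := integral_mul_fderiv_eq_neg_fderiv_mul_of_integrable (μ := volume) (f := f) (g := e)
    (v := EuclideanSpace.single j 1) (hmul hint')
    (by
      simp only [hed]
      have := (hmul hint).const_mul (-(Complex.I * b j))
      refine this.congr (ae_of_all _ fun x => ?_)
      ring)
    (hmul hint) (fun x _ => (hf.differentiable (by simp)) x)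
    (fun x _ => (hfd x).differentiableAt)
  simp only [hed] at h
  have h3 : (∫ x, f x * (-(Complex.I * b j) * e x)) = -(Complex.I * b j) * FTgs f b := by
    rw [FTgs, ← integral_const_mul]
    congr 1
    funext x
    simp only [he]
    ring
  rw [h3] at h
  have h4 : FTgs (pdGS j f) b = ∫ x, fderiv ℝ f x (EuclideanSpace.single j 1) * e x := rfl
  rw [h4]
  linear_combination h

theorem FTgs_pdGS_iterate {d : ℕ} (j : Fin d) {f : Ed d → ℂ}
    (hf : ContDiff ℝ ((⊤ : ℕ∞) : WithTop ℕ∞) f) (hint : ∀ n, Integrable ((pdGS j)^[n] f))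
    (b : Ed d) (n : ℕ) :
    FTgs ((pdGS j)^[n] f) b = (Complex.I * b j) ^ n * FTgs f b := by
  induction n with
  | zero => simp
  | succ n ih =>
    have h := hint (n + 1)
    rw [Function.iterate_succ_apply'] at h ⊢
    rw [FTgs_pdGS j (contDiff_pdGS_iterate j hf n) (hint n) h, ih]
    ring

theorem norm_FTgs_le {d : ℕ} (f : Ed d → ℂ) (b : Ed d) : ‖FTgs f b‖ ≤ ∫ x, ‖f x‖ := by
  refine (norm_integral_le_integral_norm _).trans_eq ?_
  congr 1
  funext x
  simp [Complex.norm_exp]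

theorem exists_one_add_pow_le_exp {p : ℝ} (hp : 0 < p) (N : ℕ) :
    ∃ C : ℝ, 0 < C ∧ ∀ t : ℝ, 0 ≤ t → (1 + t) ^ N ≤ C * Real.exp (t ^ p) := by
  obtain ⟨k, hk⟩ := exists_nat_ge ((N : ℝ) / p)
  rw [div_le_iff₀ hp] at hk
  have hkf : (1 : ℝ) ≤ k.factorial := by exact_mod_cast k.factorial_pos
  refine ⟨2 ^ N * k.factorial, by positivity, fun t ht => ?_⟩
  rcases le_total t 1 with h1 | h1
  · calc (1 + t) ^ N ≤ 2 ^ N := by gcongr; linarith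
      _ ≤ 2 ^ N * (k.factorial * 1) := by nlinarith [pow_pos (zero_lt_two' ℝ) N]
      _ ≤ 2 ^ N * (k.factorial * Real.exp (t ^ p)) := by
        gcongr
        exact Real.one_le_exp (by positivity)
      _ = _ := by ring
  · have h2 : t ^ N ≤ (t ^ p) ^ k := by
      rw [← Real.rpow_natCast, ← Real.rpow_natCast, ← Real.rpow_mul ht]
      exact Real.rpow_le_rpow_of_exponent_le h1 (by linarith)
    have h3 := Real.pow_div_factorial_le_exp (t ^ p) (by positivity) k
    rw [div_le_iff₀ (by positivity)] at h3
    calc (1 + t) ^ N ≤ (2 * t) ^ N := by gcongr; linarith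
      _ = 2 ^ N * t ^ N := mul_pow _ _ _
      _ ≤ 2 ^ N * (Real.exp (t ^ p) * k.factorial) := by gcongr; exact h2.trans h3
      _ = _ := by ring

theorem integrable_exp_neg_norm_rpow {E : Type*} [NormedAddCommGroup E] [NormedSpace ℝ E]
    [FiniteDimensional ℝ E] [MeasurableSpace E] [BorelSpace E] (μ : Measure E)
    [μ.IsAddHaarMeasure] {p : ℝ} (hp : 0 < p) :
    Integrable (fun x : E => Real.exp (-(‖x‖ ^ p))) μ := by
  obtain ⟨C, hC, h⟩ := exists_one_add_pow_le_exp hp (Module.finrank ℝ E + 1)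
  have h1 := (integrable_one_add_norm (μ := μ) (E := E) (r := (Module.finrank ℝ E + 1 : ℕ))
    (by push_cast; linarith)).const_mul C
  refine h1.mono' ?_ (ae_of_all _ fun x => ?_)
  · refine Continuous.aestronglyMeasurable ?_
    exact Real.continuous_exp.comp (continuous_norm.rpow_const fun _ => Or.inr hp.le).neg
  · rw [Real.norm_of_nonneg (Real.exp_pos _).le, Real.exp_neg, Real.rpow_neg (by positivity),
      Real.rpow_natCast, ← div_eq_mul_inv, le_div_iff₀ (by positivity), inv_mul_le_iff₀ (Real.exp_pos _)]
    linarith [h ‖x‖ (norm_nonneg x)]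

theorem add_rpow_le_two_rpow_mul {p a b : ℝ} (hp : 0 < p) (ha : 0 ≤ a) (hb : 0 ≤ b) :
    (a + b) ^ p ≤ 2 ^ p * (a ^ p + b ^ p) := by
  have h1 : a + b ≤ 2 * max a b := by linarith [le_max_left a b, le_max_right a b]
  have h2 : (max a b) ^ p ≤ a ^ p + b ^ p := by
    rcases max_cases a b with ⟨h, -⟩ | ⟨h, -⟩ <;> rw [h]
    · linarith [Real.rpow_nonneg hb p]
    · linarith [Real.rpow_nonneg ha p]
  calc (a + b) ^ p ≤ (2 * max a b) ^ p := Real.rpow_le_rpow (by positivity) h1 hp.le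
    _ = 2 ^ p * (max a b) ^ p := Real.mul_rpow (by norm_num) (le_max_of_le_left ha)
    _ ≤ _ := by gcongr

theorem norm_prod_rpow_le {E F : Type*} [NormedAddCommGroup E] [NormedAddCommGroup F] {p : ℝ}
    (z : E × F) : ‖z‖ ^ p ≤ ‖z.1‖ ^ p + ‖z.2‖ ^ p := by
  rw [Prod.norm_def]
  rcases max_cases ‖z.1‖ ‖z.2‖ with ⟨h, -⟩ | ⟨h, -⟩ <;> rw [h]
  · linarith [Real.rpow_nonneg (norm_nonneg z.2) p]
  · linarith [Real.rpow_nonneg (norm_nonneg z.1) p]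

theorem sum_choose_mul_gevrey_le {s h C₁ C₂ : ℝ} (hs : 0 < s) (hh : 0 < h) (h₁ : 0 ≤ C₁)
    (h₂ : 0 ≤ C₂) (n : ℕ) :
    ∑ i ∈ Finset.range (n + 1), (n.choose i : ℝ) * (C₁ * (h ^ i * (i.factorial : ℝ) ^ s)) *
      (C₂ * (h ^ (n - i) * ((n - i).factorial : ℝ) ^ s))
      ≤ C₁ * C₂ * ((2 * h) ^ n * (n.factorial : ℝ) ^ s) := by
  have hsum : (∑ i ∈ Finset.range (n + 1), (n.choose i : ℝ)) = 2 ^ n := by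
    exact_mod_cast Nat.sum_range_choose n
  calc _ ≤ ∑ i ∈ Finset.range (n + 1), (n.choose i : ℝ) *
        (C₁ * C₂ * (h ^ n * (n.factorial : ℝ) ^ s)) := by
        refine Finset.sum_le_sum fun i hi => ?_
        have hi' : i ≤ n := Nat.lt_succ_iff.1 (Finset.mem_range.1 hi)
        have hfac : ((i.factorial : ℝ) * ((n - i).factorial : ℝ)) ^ s ≤ (n.factorial : ℝ) ^ s := by
          refine Real.rpow_le_rpow (by positivity) ?_ hs.le
          exact_mod_cast Nat.le_of_dvd n.factorial_pos (Nat.factorial_mul_factorial_dvd_factorial hi')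
        rw [Real.mul_rpow (by positivity) (by positivity)] at hfac
        have hpow : h ^ n = h ^ i * h ^ (n - i) := by rw [← pow_add, Nat.add_sub_cancel' hi']
        calc _ = (n.choose i : ℝ) * (C₁ * C₂ * (h ^ n *
              ((i.factorial : ℝ) ^ s * ((n - i).factorial : ℝ) ^ s))) := by rw [hpow]; ring
          _ ≤ _ := by gcongr
    _ = _ := by rw [← Finset.sum_mul, hsum, mul_pow]; ring

/-- The Fourier transforms of the products `conj ψ · φ(· - a)` decay jointly in both variables. -/
theorem exists_norm_FTgs_window_le {d : ℕ} (hd : 0 < d) {s : ℝ} (hs : 0 < s) {φ ψ : Ed d → ℂ}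
    (hφ : φ ∈ SigmaGS s d) (hψ : ψ ∈ SigmaGS s d) {A : ℝ} (hA : 0 < A) :
    ∃ C : ℝ, 0 ≤ C ∧ ∀ z : Ed d × Ed d,
      ‖FTgs (fun y => (starRingEnd ℂ) (ψ y) * φ (y - z.1)) z.2‖
        ≤ C * Real.exp (-(A * ‖z‖ ^ (1 / s))) := by
  obtain ⟨h₀, hh₀, hsc⟩ := exists_scale_coord hd hs hA
  have hp : 0 < 1 / s := one_div_pos.2 hs
  obtain ⟨C₁, hC₁, h₁⟩ := SigmaGS.exists_exp_bound hd hs hψ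
    (A := 2 ^ (1 / s) * A + 1) (by positivity) (half_pos hh₀)
  obtain ⟨C₂, hC₂, h₂⟩ := SigmaGS.exists_exp_bound hd hs hφ
    (A := 2 ^ (1 / s) * A) (by positivity) (half_pos hh₀)
  set J : ℝ := ∫ y : Ed d, Real.exp (-(‖y‖ ^ (1 / s))) with hJ
  have hJ0 : 0 ≤ J := integral_nonneg fun _ => (Real.exp_pos _).le
  refine ⟨2 ^ s * (C₁ * C₂ * J), by positivity, fun ⟨a, b⟩ => ?_⟩
  set q : Ed d → ℂ := fun y => (starRingEnd ℂ) (ψ y) * φ (y - a) with hq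
  have hψc : ContDiff ℝ ((⊤ : ℕ∞) : WithTop ℕ∞) fun y => (starRingEnd ℂ) (ψ y) :=
    Complex.conjCLE.contDiff.comp hψ.1
  have hφc : ContDiff ℝ ((⊤ : ℕ∞) : WithTop ℕ∞) fun y => φ (y - a) :=
    hφ.1.comp (contDiff_id.sub contDiff_const)
  have hqc : ContDiff ℝ ((⊤ : ℕ∞) : WithTop ℕ∞) q := hψc.mul hφc
  have hder : ∀ (j : Fin d) (n : ℕ) (y : Ed d), ‖(pdGS j)^[n] q y‖ ≤
      C₁ * C₂ * Real.exp (-(A * ‖a‖ ^ (1 / s))) * (h₀ ^ n * (n.factorial : ℝ) ^ s) *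
        Real.exp (-(‖y‖ ^ (1 / s))) := by
    intro j n y
    have hL := norm_pdGS_iterate_mul_le j hψc hφc n y
    simp only [pdGS_iterate_conj, pdGS_iterate_comp_sub, RCLike.norm_conj] at hL
    set e₁ := Real.exp (-((2 ^ (1 / s) * A + 1) * ‖y‖ ^ (1 / s)))
    set e₂ := Real.exp (-(2 ^ (1 / s) * A * ‖y - a‖ ^ (1 / s)))
    have hexp : e₁ * e₂ ≤ Real.exp (-(A * ‖a‖ ^ (1 / s))) * Real.exp (-(‖y‖ ^ (1 / s))) := by
      rw [← Real.exp_add, ← Real.exp_add]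
      refine Real.exp_le_exp.2 ?_
      have h3 : ‖a‖ ≤ ‖y‖ + ‖y - a‖ := by
        simpa using norm_sub_le y (y - a)
      have h4 := (Real.rpow_le_rpow (norm_nonneg _) h3 hp.le).trans
        (add_rpow_le_two_rpow_mul hp (norm_nonneg y) (norm_nonneg (y - a)))
      have h5 := mul_le_mul_of_nonneg_left h4 hA.le
      linarith
    calc _ ≤ _ := hL
      _ ≤ ∑ i ∈ Finset.range (n + 1), (n.choose i : ℝ) *
          (C₁ * ((h₀ / 2) ^ i * (i.factorial : ℝ) ^ s) * e₁) *
          (C₂ * ((h₀ / 2) ^ (n - i) * ((n - i).factorial : ℝ) ^ s) * e₂) := by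
        refine Finset.sum_le_sum fun i _ => ?_
        gcongr
        · exact h₁ y j i
        · exact h₂ (y - a) j (n - i)
      _ = (∑ i ∈ Finset.range (n + 1), (n.choose i : ℝ) *
          (C₁ * ((h₀ / 2) ^ i * (i.factorial : ℝ) ^ s)) *
          (C₂ * ((h₀ / 2) ^ (n - i) * ((n - i).factorial : ℝ) ^ s))) * (e₁ * e₂) := by
        rw [Finset.sum_mul]
        exact Finset.sum_congr rfl fun i _ => by ring
      _ ≤ (C₁ * C₂ * ((2 * (h₀ / 2)) ^ n * (n.factorial : ℝ) ^ s)) *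
          (Real.exp (-(A * ‖a‖ ^ (1 / s))) * Real.exp (-(‖y‖ ^ (1 / s)))) := by
        gcongr
        exact sum_choose_mul_gevrey_le hs (half_pos hh₀) hC₁ hC₂ n
      _ = _ := by rw [mul_div_cancel₀ _ (two_ne_zero' ℝ)]; ring
  have hJi := integrable_exp_neg_norm_rpow (volume : Measure (Ed d)) hp
  have hint : ∀ (j : Fin d) (n : ℕ), Integrable ((pdGS j)^[n] q) := fun j n =>
    (hJi.const_mul _).mono' (contDiff_pdGS_iterate j hqc n).continuous.aestronglyMeasurable
      (ae_of_all _ (hder j n))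
  obtain ⟨j, hj⟩ := hsc h₀ hh₀ le_rfl b
  have hfin := le_exp_of_forall_pow_mul_le (M := C₁ * C₂ * Real.exp (-(A * ‖a‖ ^ (1 / s))) * J)
    hs hh₀ (abs_nonneg (b j)) (by positivity) (norm_nonneg (FTgs q b)) fun n => by
      have h6 : |b j| ^ n * ‖FTgs q b‖ = ‖FTgs ((pdGS j)^[n] q) b‖ := by
        rw [FTgs_pdGS_iterate j hqc (hint j) b n]
        simp
      rw [h6]
      refine (norm_FTgs_le _ _).trans ?_
      refine (integral_mono (hint j n).norm (hJi.const_mul _) (hder j n)).trans_eq ?_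
      rw [integral_const_mul]
      ring
  refine hfin.trans ?_
  have hab := norm_prod_rpow_le (p := 1 / s) (a, b)
  calc _ ≤ 2 ^ s * (C₁ * C₂ * Real.exp (-(A * ‖a‖ ^ (1 / s))) * J) *
        Real.exp (-(A * ‖b‖ ^ (1 / s))) := by gcongr
    _ = 2 ^ s * (C₁ * C₂ * J) *
        Real.exp (-(A * ‖a‖ ^ (1 / s)) + -(A * ‖b‖ ^ (1 / s))) := by rw [Real.exp_add]; ring
    _ ≤ _ := by
      gcongr
      have := mul_le_mul_of_nonneg_left hab hA.le
      simp only at this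
      linarith

set_option maxSynthPendingDepth 3 in
theorem contDiff_iteratedFDeriv_param {W E G : Type*} [NormedAddCommGroup W] [NormedSpace ℝ W]
    [NormedAddCommGroup E] [NormedSpace ℝ E] [NormedAddCommGroup G] [NormedSpace ℝ G]
    {F : W → E → G} (hF : ContDiff ℝ ((⊤ : ℕ∞) : WithTop ℕ∞) fun p : W × E => F p.1 p.2) (n : ℕ) :
    ContDiff ℝ ((⊤ : ℕ∞) : WithTop ℕ∞) fun p : W × E => iteratedFDeriv ℝ n (F p.1) p.2 := by
  induction n with
  | zero =>
    simp only [iteratedFDeriv_zero_eq_comp]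
    exact (continuousMultilinearCurryFin0 ℝ E G).symm.contDiff.comp hF
  | succ n ih =>
    simp only [iteratedFDeriv_succ_eq_comp_left]
    refine (continuousMultilinearCurryLeftEquiv ℝ (fun _ : Fin (n + 1) => E)
      G).symm.contDiff.comp ?_
    refine ContDiff.fderiv (m := ((⊤ : ℕ∞) : WithTop ℕ∞))
      (f := fun (p : W × E) (y : E) => iteratedFDeriv ℝ n (F p.1) y) ?_ contDiff_snd (by simp)
    exact ih.comp ((contDiff_fst.comp contDiff_fst).prodMk contDiff_snd)

theorem iteratedDeriv_cexp_const_mul_ofReal (n : ℕ) (c : ℂ) (t : ℝ) :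
    iteratedDeriv n (fun t : ℝ => Complex.exp (c * t)) t = c ^ n * Complex.exp (c * t) := by
  induction n generalizing t with
  | zero => simp
  | succ n ih =>
    rw [iteratedDeriv_succ, funext ih]
    have h := ((((hasDerivAt_id t).ofReal_comp).const_mul c).cexp).const_mul (c ^ n)
    rw [show (fun t : ℝ => c ^ n * Complex.exp (c * t)) =
      fun t : ℝ => c ^ n * Complex.exp (c * ((id t : ℝ) : ℂ)) from rfl, h.deriv]
    simp only [id, Complex.ofReal_one]
    ring

theorem norm_iteratedFDeriv_cexp_inner_le {E : Type*} [NormedAddCommGroup E]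
    [InnerProductSpace ℝ E] (ξ : E) (n : ℕ) (y : E) :
    ‖iteratedFDeriv ℝ n (fun y : E => Complex.exp (-(Complex.I * (⟪y, ξ⟫ : ℝ)))) y‖
      ≤ ‖ξ‖ ^ n := by
  set e : ℝ → ℂ := fun t : ℝ => Complex.exp (-Complex.I * t) with he
  have hec : ContDiff ℝ n e := by
    rw [he]
    exact (contDiff_const.mul Complex.ofRealCLM.contDiff).cexp
  have h1 : (fun y : E => Complex.exp (-(Complex.I * (⟪y, ξ⟫ : ℝ)))) = e ∘ innerSL ℝ ξ := by
    funext y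
    simp only [he, Function.comp_apply]
    rw [innerSL_apply_apply, real_inner_comm, neg_mul]
  rw [h1, ContinuousLinearMap.iteratedFDeriv_comp_right _ hec y le_rfl]
  refine (ContinuousMultilinearMap.norm_compContinuousLinearMap_le _ _).trans_eq ?_
  rw [norm_iteratedFDeriv_eq_norm_iteratedDeriv, he, iteratedDeriv_cexp_const_mul_ofReal]
  simp [Complex.norm_exp]

theorem contDiff_tfShift {d : ℕ} (φ : 𝓢(Ed d, ℂ)) :
    ContDiff ℝ ((⊤ : ℕ∞) : WithTop ℕ∞) fun p : (Ed d × Ed d) × Ed d =>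
      (starRingEnd ℂ) (φ (p.2 - p.1.1)) * Complex.exp (-(Complex.I * (⟪p.2, p.1.2⟫ : ℝ))) := by
  have h1 : ContDiff ℝ ((⊤ : ℕ∞) : WithTop ℕ∞) fun p : (Ed d × Ed d) × Ed d =>
      (starRingEnd ℂ) (φ (p.2 - p.1.1)) :=
    Complex.conjCLE.contDiff.comp
      ((φ.smooth ⊤).comp (contDiff_snd.sub (contDiff_fst.comp contDiff_fst)))
  refine h1.mul (ContDiff.cexp (contDiff_const.mul ?_).neg)
  exact Complex.ofRealCLM.contDiff.comp (contDiff_snd.inner ℝ (contDiff_snd.comp contDiff_fst))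

theorem exists_tfShift_bound {d : ℕ} (φ : 𝓢(Ed d, ℂ)) (k n : ℕ) :
    ∃ C : ℝ, 0 ≤ C ∧ ∀ (w : Ed d × Ed d) (y : Ed d), ‖y‖ ^ k * ‖iteratedFDeriv ℝ n
      (fun y => (starRingEnd ℂ) (φ (y - w.1)) * Complex.exp (-(Complex.I * (⟪y, w.2⟫ : ℝ)))) y‖
        ≤ C * (1 + ‖w‖) ^ (k + n) := by
  set M : ℝ := 2 ^ (k, n).1 *
    (Finset.Iic (k, n)).sup (fun m => SchwartzMap.seminorm ℝ m.1 m.2) φ with hM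
  have hM0 : 0 ≤ M := by positivity
  have hφ : ∀ i ≤ n, ∀ x, (1 + ‖x‖) ^ k * ‖iteratedFDeriv ℝ i φ x‖ ≤ M := fun i hi x =>
    SchwartzMap.one_add_le_sup_seminorm_apply (𝕜 := ℝ) (m := (k, n)) le_rfl hi φ x
  refine ⟨2 ^ n * M, by positivity, fun w y => ?_⟩
  have hw1 : ‖w.1‖ ≤ ‖w‖ := norm_fst_le w
  have hw2 : ‖w.2‖ ≤ ‖w‖ := norm_snd_le w
  have hc : ContDiff ℝ ((⊤ : ℕ∞) : WithTop ℕ∞) fun y => φ (y - w.1) :=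
    (φ.smooth ⊤).comp (contDiff_id.sub contDiff_const)
  have hc' : ContDiff ℝ ((⊤ : ℕ∞) : WithTop ℕ∞) fun y => (starRingEnd ℂ) (φ (y - w.1)) :=
    Complex.conjCLE.contDiff.comp hc
  have he : ContDiff ℝ ((⊤ : ℕ∞) : WithTop ℕ∞)
      fun y : Ed d => Complex.exp (-(Complex.I * (⟪y, w.2⟫ : ℝ))) :=
    (contDiff_const.mul (Complex.ofRealCLM.contDiff.comp
      (contDiff_id.inner ℝ contDiff_const))).neg.cexp
  have hder : ∀ i ≤ n, ‖y‖ ^ k *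
      ‖iteratedFDeriv ℝ i (fun y => (starRingEnd ℂ) (φ (y - w.1))) y‖ ≤ (1 + ‖w‖) ^ k * M := by
    intro i hi
    have h1 : ‖iteratedFDeriv ℝ i (fun y => (starRingEnd ℂ) (φ (y - w.1))) y‖
        = ‖iteratedFDeriv ℝ i φ (y - w.1)‖ := by
      rw [← iteratedFDeriv_comp_sub]
      exact Complex.conjLIE.norm_iteratedFDeriv_comp_left (fun y => φ (y - w.1)) y i
    rw [h1]
    have h2 : ‖y‖ ≤ (1 + ‖w‖) * (1 + ‖y - w.1‖) := by
      have := norm_le_norm_sub_add y w.1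
      nlinarith [norm_nonneg w, norm_nonneg (y - w.1)]
    calc ‖y‖ ^ k * ‖iteratedFDeriv ℝ i φ (y - w.1)‖
        ≤ ((1 + ‖w‖) * (1 + ‖y - w.1‖)) ^ k * ‖iteratedFDeriv ℝ i φ (y - w.1)‖ := by gcongr
      _ = (1 + ‖w‖) ^ k * ((1 + ‖y - w.1‖) ^ k * ‖iteratedFDeriv ℝ i φ (y - w.1)‖) := by
        rw [mul_pow]; ring
      _ ≤ _ := by gcongr; exact hφ i hi _
  have hL := norm_iteratedFDeriv_mul_le (𝕜 := ℝ) hc' he y (n := n) (WithTop.coe_le_coe.2 le_top)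
  have hsum : (∑ i ∈ Finset.range (n + 1), (n.choose i : ℝ)) = 2 ^ n := by
    exact_mod_cast Nat.sum_range_choose n
  refine (mul_le_mul_of_nonneg_left hL (by positivity)).trans ?_
  rw [Finset.mul_sum]
  calc _ ≤ ∑ i ∈ Finset.range (n + 1), (n.choose i : ℝ) * ((1 + ‖w‖) ^ k * M * (1 + ‖w‖) ^ n) := by
        refine Finset.sum_le_sum fun i hi => ?_
        have hi' : i ≤ n := Nat.lt_succ_iff.1 (Finset.mem_range.1 hi)
        have h3 : ‖iteratedFDeriv ℝ (n - i)
            (fun y : Ed d => Complex.exp (-(Complex.I * (⟪y, w.2⟫ : ℝ)))) y‖ ≤ (1 + ‖w‖) ^ n :=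
          calc _ ≤ ‖w.2‖ ^ (n - i) := norm_iteratedFDeriv_cexp_inner_le w.2 (n - i) y
            _ ≤ (1 + ‖w‖) ^ (n - i) := by gcongr; linarith
            _ ≤ (1 + ‖w‖) ^ n := by
              gcongr
              · linarith [norm_nonneg w]
              · omega
        calc _ = (n.choose i : ℝ) * ((‖y‖ ^ k *
              ‖iteratedFDeriv ℝ i (fun y => (starRingEnd ℂ) (φ (y - w.1))) y‖) *
              ‖iteratedFDeriv ℝ (n - i)
                (fun y : Ed d => Complex.exp (-(Complex.I * (⟪y, w.2⟫ : ℝ)))) y‖) := by ring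
          _ ≤ _ := mul_le_mul_of_nonneg_left
            (mul_le_mul (hder i hi') h3 (norm_nonneg _) (by positivity)) (Nat.cast_nonneg _)
    _ = _ := by rw [← Finset.sum_mul, hsum, pow_add]; ring

/-- The time-frequency shift `y ↦ conj (φ (y - x)) e^{-i⟨y, ξ⟩}` of a Schwartz window. -/
def tfShift {d : ℕ} (φ : 𝓢(Ed d, ℂ)) (w : Ed d × Ed d) : 𝓢(Ed d, ℂ) where
  toFun y := (starRingEnd ℂ) (φ (y - w.1)) * Complex.exp (-(Complex.I * (⟪y, w.2⟫ : ℝ)))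
  smooth' := (contDiff_tfShift φ).comp (contDiff_const.prodMk contDiff_id)
  decay' k n := by
    obtain ⟨C, -, hC⟩ := exists_tfShift_bound φ k n
    exact ⟨_, hC w⟩

theorem tfShift_apply {d : ℕ} (φ : 𝓢(Ed d, ℂ)) (w : Ed d × Ed d) (y : Ed d) :
    tfShift φ w y =
      (starRingEnd ℂ) (φ (y - w.1)) * Complex.exp (-(Complex.I * (⟪y, w.2⟫ : ℝ))) := rfl

theorem continuous_iteratedFDeriv_tfShift {d : ℕ} (φ : 𝓢(Ed d, ℂ)) (n : ℕ) :
    Continuous fun p : (Ed d × Ed d) × Ed d => iteratedFDeriv ℝ n (tfShift φ p.1) p.2 :=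
  (contDiff_iteratedFDeriv_param (F := fun w y => tfShift φ w y) (contDiff_tfShift φ) n).continuous

theorem exists_seminorm_tfShift_le {d : ℕ} (φ : 𝓢(Ed d, ℂ)) {p : ℝ} (hp : 0 < p) (k n : ℕ) :
    ∃ C : ℝ, 0 ≤ C ∧ ∀ (w : Ed d × Ed d) (y : Ed d),
      ‖y‖ ^ k * ‖iteratedFDeriv ℝ n (tfShift φ w) y‖ ≤ C * Real.exp (‖w‖ ^ p) := by
  obtain ⟨C, hC0, hC⟩ := exists_tfShift_bound φ k n
  obtain ⟨C', hC0', hC'⟩ := exists_one_add_pow_le_exp hp (k + n)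
  refine ⟨C * C', by positivity, fun w y => (hC w y).trans ?_⟩
  rw [mul_assoc]
  exact mul_le_mul_of_nonneg_left (hC' _ (norm_nonneg w)) hC0

/-- The short-time Fourier transform of a tempered distribution grows at most polynomially, hence
slower than any stretched exponential. -/
theorem exists_norm_apply_tfShift_le {d : ℕ} (u : TD d) (φ : 𝓢(Ed d, ℂ)) {p : ℝ} (hp : 0 < p) :
    ∃ C : ℝ, 0 ≤ C ∧ ∀ w : Ed d × Ed d, ‖u (tfShift φ w)‖ ≤ C * Real.exp (‖w‖ ^ p) := by
  obtain ⟨S, C, -, hS⟩ := Seminorm.bound_of_continuous (schwartz_withSeminorms ℂ (Ed d) ℂ)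
    ((normSeminorm ℂ ℂ).comp u.toLinearMap) (by
      exact continuous_norm.comp u.continuous)
  choose B hB0 hB using fun q : ℕ × ℕ => exists_seminorm_tfShift_le φ hp q.1 q.2
  refine ⟨C * ∑ q ∈ S, B q, mul_nonneg C.2 (Finset.sum_nonneg fun q _ => hB0 q), fun w => ?_⟩
  refine (hS (tfShift φ w)).trans ?_
  rw [smul_apply, NNReal.smul_def, smul_eq_mul, mul_assoc]
  refine mul_le_mul_of_nonneg_left ?_ C.2
  rw [Finset.sum_mul]
  refine Seminorm.finset_sup_apply_le (Finset.sum_nonneg fun q _ =>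
    mul_nonneg (hB0 q) (Real.exp_pos _).le) fun q hq => ?_
  refine le_trans ?_ (Finset.single_le_sum (f := fun q => B q * Real.exp (‖w‖ ^ p))
    (fun q _ => mul_nonneg (hB0 q) (Real.exp_pos _).le) hq)
  exact SchwartzMap.seminorm_le_bound ℂ q.1 q.2 _ (mul_nonneg (hB0 q) (Real.exp_pos _).le) (hB q w)

theorem integral_FTgs_mul_cexp {d : ℕ} {q : Ed d → ℂ} (hc : Continuous q) (hq : Integrable q)
    (hF : Integrable (FTgs q)) (y : Ed d) :
    ∫ η, FTgs q η * Complex.exp (Complex.I * (⟪y, η⟫ : ℝ)) = ((2 * Real.pi) ^ d : ℝ) * q y := by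
  have hpi : (0 : ℝ) < 2 * Real.pi := by positivity
  have h1 : ∀ w : Ed d, FourierTransform.fourier q w = FTgs q ((2 * Real.pi) • w) := by
    intro w
    rw [Real.fourier_eq', FTgs]
    congr 1
    funext v
    rw [smul_eq_mul, mul_comm, inner_smul_right]
    congr 2
    push_cast
    ring
  have h2 : Integrable (FourierTransform.fourier q) := by
    rw [funext h1]
    exact hF.comp_smul hpi.ne'
  have h3 := congrFun (hc.fourierInv_fourier_eq hq h2) y
  rw [Real.fourierInv_eq'] at h3
  have h4 := Measure.integral_comp_smul (volume : Measure (Ed d))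
    (fun η => FTgs q η * Complex.exp (Complex.I * (⟪y, η⟫ : ℝ))) (2 * Real.pi)
  have h5 : (∫ w : Ed d, FTgs q ((2 * Real.pi) • w) *
      Complex.exp (Complex.I * (⟪y, (2 * Real.pi) • w⟫ : ℝ))) = q y := by
    rw [← h3]
    congr 1
    funext w
    rw [h1, smul_eq_mul, mul_comm, inner_smul_right, real_inner_comm]
    congr 2
    push_cast
    ring
  rw [h5] at h4
  rw [h4, finrank_euclideanSpace_fin, abs_of_pos (by positivity), Complex.real_smul, ← mul_assoc,
    ← Complex.ofReal_mul, mul_inv_cancel₀ (by positivity), Complex.ofReal_one, one_mul]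

/-- The kernel expressing one short-time Fourier transform through another. -/
def stftKernel {d : ℕ} (φ ψ : 𝓢(Ed d, ℂ)) (z w : Ed d × Ed d) : ℂ :=
  FTgs (fun y => (starRingEnd ℂ) (ψ (y - z.1)) * φ (y - w.1)) (z.2 - w.2)

theorem norm_stftKernel {d : ℕ} (φ ψ : 𝓢(Ed d, ℂ)) (z w : Ed d × Ed d) :
    ‖stftKernel φ ψ z w‖ =
      ‖FTgs (fun y => (starRingEnd ℂ) (ψ y) * φ (y - (w.1 - z.1))) (z.2 - w.2)‖ := by
  have h : stftKernel φ ψ z w = Complex.exp (-(Complex.I * (⟪z.1, z.2 - w.2⟫ : ℝ))) *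
      FTgs (fun y => (starRingEnd ℂ) (ψ y) * φ (y - (w.1 - z.1))) (z.2 - w.2) := by
    simp only [stftKernel, FTgs]
    rw [← integral_add_right_eq_self _ z.1, ← integral_const_mul]
    congr 1
    funext y
    rw [add_sub_cancel_right, inner_add_left, show y + z.1 - w.1 = y - (w.1 - z.1) by abel,
      mul_left_comm, ← Complex.exp_add]
    congr 2
    push_cast
    ring
  rw [h, norm_mul, Complex.norm_exp]
  simp

theorem continuous_stftKernel {d : ℕ} (φ ψ : 𝓢(Ed d, ℂ)) (z : Ed d × Ed d) :
    Continuous (stftKernel φ ψ z) := by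
  unfold stftKernel FTgs
  refine continuous_of_dominated (bound := fun y => ‖ψ (y - z.1)‖ * SchwartzMap.seminorm ℝ 0 0 φ)
    (fun w => ?_) (fun w => ae_of_all _ fun y => ?_) ?_ (ae_of_all _ fun y => ?_)
  · refine Continuous.aestronglyMeasurable ?_
    have := φ.continuous
    have := ψ.continuous
    have hc := Complex.continuous_conj
    fun_prop
  · rw [norm_mul, norm_mul, RCLike.norm_conj, Complex.norm_exp]
    simp only [Complex.neg_re, Complex.mul_re, Complex.I_re, Complex.ofReal_re, Complex.I_im,
      Complex.ofReal_im, zero_mul, mul_zero, sub_zero, neg_zero, Real.exp_zero, mul_one]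
    gcongr
    exact SchwartzMap.norm_le_seminorm ℝ φ _
  · exact (ψ.integrable.comp_sub_right z.1).norm.mul_const _
  · have := φ.continuous
    have := ψ.continuous
    fun_prop

theorem integrable_conj_mul {d : ℕ} (φ ψ : 𝓢(Ed d, ℂ)) :
    Integrable fun y => (starRingEnd ℂ) (ψ y) * φ y := by
  refine (ψ.integrable.norm.mul_const (SchwartzMap.seminorm ℝ 0 0 φ)).mono' ?_
    (ae_of_all _ fun y => ?_)
  · exact ((Complex.continuous_conj.comp ψ.continuous).mul φ.continuous).aestronglyMeasurable
  · rw [norm_mul, RCLike.norm_conj]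
    gcongr
    exact SchwartzMap.norm_le_seminorm ℝ φ _

theorem integral_conj_mul_self_ne_zero {d : ℕ} (φ : 𝓢(Ed d, ℂ)) {y₀ : Ed d} (h : φ y₀ ≠ 0) :
    ∫ y, (starRingEnd ℂ) (φ y) * φ y ≠ 0 := by
  have h1 : ∀ y, (starRingEnd ℂ) (φ y) * φ y = ((‖φ y‖ ^ 2 : ℝ) : ℂ) := fun y => by
    rw [Complex.conj_mul']
    push_cast
    rfl
  have h2 : Integrable fun y => ‖φ y‖ ^ 2 := by
    have := (integrable_conj_mul φ φ).norm
    refine this.congr (ae_of_all _ fun y => ?_)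
    simp [sq]
  simp only [h1]
  rw [integral_complex_ofReal]
  refine Complex.ofReal_ne_zero.2 (ne_of_gt ?_)
  rw [integral_pos_iff_support_of_nonneg (fun y => by positivity) h2]
  refine IsOpen.measure_pos _ ?_ ⟨y₀, by simpa using h⟩
  exact isOpen_ne.preimage (φ.continuous.norm.pow 2)

section Reproducing

variable {d : ℕ} {φ ψ : 𝓢(Ed d, ℂ)} {p : ℝ}

theorem integrable_exp_neg_norm_sub_rpow (hp : 0 < p) (z : Ed d × Ed d) :
    Integrable fun w : Ed d × Ed d => Real.exp (-(‖z - w‖ ^ p)) := by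
  have : (volume : Measure (Ed d × Ed d)).IsAddHaarMeasure := by
    rw [Measure.volume_eq_prod]
    infer_instance
  simp only [norm_sub_rev z]
  exact (integrable_exp_neg_norm_rpow (volume : Measure (Ed d × Ed d)) hp).comp_sub_right z

/-- Pointwise reproducing formula for time-frequency shifts. -/
theorem integral_stftKernel_mul_tfShift (hp : 0 < p) {C : ℝ} (hC : 0 ≤ C)
    (hK : ∀ z w : Ed d × Ed d, ‖stftKernel φ ψ z w‖ ≤ C * Real.exp (-(‖z - w‖ ^ p)))
    (z : Ed d × Ed d) (y : Ed d) :
    ∫ w, stftKernel φ ψ z w * tfShift φ w y =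
      (((2 * Real.pi) ^ d : ℝ) * ∫ v, (starRingEnd ℂ) (φ v) * φ v) * tfShift ψ z y := by
  have hφb : ∀ x, ‖φ x‖ ≤ SchwartzMap.seminorm ℝ 0 0 φ := SchwartzMap.norm_le_seminorm ℝ φ
  have hshift : ∀ (w : Ed d × Ed d), ‖tfShift φ w y‖ ≤ SchwartzMap.seminorm ℝ 0 0 φ := by
    intro w
    rw [tfShift_apply, norm_mul, RCLike.norm_conj, Complex.norm_exp]
    simpa using hφb (y - w.1)
  have hsc : Continuous fun w => tfShift φ w y :=
    (contDiff_tfShift φ).continuous.comp (continuous_id.prodMk continuous_const)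
  have hkc := continuous_stftKernel φ ψ z
  have hint : Integrable fun w => stftKernel φ ψ z w * tfShift φ w y := by
    refine (((integrable_exp_neg_norm_sub_rpow hp z).const_mul C).mul_const
      (SchwartzMap.seminorm ℝ 0 0 φ)).mono' (hkc.mul hsc).aestronglyMeasurable
      (ae_of_all _ fun w => ?_)
    rw [norm_mul]
    exact mul_le_mul (hK z w) (hshift w) (norm_nonneg _) (by positivity)
  rw [Measure.volume_eq_prod] at hint ⊢
  rw [integral_prod _ hint]
  have hinner : ∀ a : Ed d, ∫ b, stftKernel φ ψ z (a, b) * tfShift φ (a, b) y =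
      ((2 * Real.pi) ^ d : ℝ) * tfShift ψ z y * ((starRingEnd ℂ) (φ (y - a)) * φ (y - a)) := by
    intro a
    set q : Ed d → ℂ := fun y => (starRingEnd ℂ) (ψ (y - z.1)) * φ (y - a) with hq
    have hqc : Continuous q := (Complex.continuous_conj.comp (ψ.continuous.comp
      (continuous_id.sub continuous_const))).mul (φ.continuous.comp
      (continuous_id.sub continuous_const))
    have hqi : Integrable q := by
      refine ((ψ.integrable.comp_sub_right z.1).norm.mul_const
        (SchwartzMap.seminorm ℝ 0 0 φ)).mono' hqc.aestronglyMeasurable (ae_of_all _ fun y => ?_)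
      rw [hq, norm_mul, RCLike.norm_conj]
      gcongr
      exact hφb _
    have hF : ∀ η, FTgs q η = stftKernel φ ψ z (a, z.2 - η) := fun η => by
      simp [stftKernel, hq]
    have hFi : Integrable (FTgs q) := by
      refine ((integrable_exp_neg_norm_rpow (volume : Measure (Ed d)) hp).const_mul C).mono' ?_
        (ae_of_all _ fun η => ?_)
      · rw [funext hF]
        exact (hkc.comp (continuous_const.prodMk
          (continuous_const.sub continuous_id))).aestronglyMeasurable
      · rw [hF]
        refine (hK _ _).trans ?_
        gcongr
        refine le_trans (le_of_eq ?_) (norm_snd_le _)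
        simp
    have hinv := integral_FTgs_mul_cexp hqc hqi hFi y
    rw [← integral_sub_left_eq_self _ _ z.2]
    have hre : ∀ η, stftKernel φ ψ z (a, z.2 - η) * tfShift φ (a, z.2 - η) y =
        (starRingEnd ℂ) (φ (y - a)) * Complex.exp (-(Complex.I * (⟪y, z.2⟫ : ℝ))) *
          (FTgs q η * Complex.exp (Complex.I * (⟪y, η⟫ : ℝ))) := by
      intro η
      rw [hF, tfShift_apply, inner_sub_right]
      have : Complex.exp (-(Complex.I * ((⟪y, z.2⟫ - ⟪y, η⟫ : ℝ) : ℂ))) =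
          Complex.exp (-(Complex.I * (⟪y, z.2⟫ : ℝ))) * Complex.exp (Complex.I * (⟪y, η⟫ : ℝ)) := by
        rw [← Complex.exp_add]
        congr 1
        push_cast
        ring
      rw [this]
      ring
    simp only [hre]
    rw [integral_const_mul, hinv, tfShift_apply, hq]
    ring
  simp only [hinner]
  rw [integral_const_mul, integral_sub_left_eq_self (fun v => (starRingEnd ℂ) (φ v) * φ v) volume y]
  ring

/-- Change-of-window formula for the short-time Fourier transform of a tempered distribution. -/
theorem apply_tfShift_eq_integral (hp : 0 < p)
    (hK : ∀ A : ℝ, 0 < A → ∃ C : ℝ, 0 ≤ C ∧ ∀ z w : Ed d × Ed d,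
      ‖stftKernel φ ψ z w‖ ≤ C * Real.exp (-(A * ‖z - w‖ ^ p))) (u : TD d) (z : Ed d × Ed d) :
    (((2 * Real.pi) ^ d : ℝ) * ∫ v, (starRingEnd ℂ) (φ v) * φ v) * u (tfShift ψ z) =
      ∫ w, stftKernel φ ψ z w * u (tfShift φ w) := by
  set c : ℂ := ((2 * Real.pi) ^ d : ℝ) * ∫ v, (starRingEnd ℂ) (φ v) * φ v with hc
  obtain ⟨C₁, hC₁, h₁⟩ := hK 1 one_pos
  simp only [one_mul] at h₁
  obtain ⟨C₂, hC₂, h₂⟩ := hK (2 ^ p + 1) (by positivity)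
  have hkc := continuous_stftKernel φ ψ z
  have hd : ∀ (a : ℂ) (f : 𝓢(Ed d, ℂ)) (n : ℕ) (y : Ed d),
      iteratedFDeriv ℝ n (a • f : 𝓢(Ed d, ℂ)) y = a • iteratedFDeriv ℝ n f y := fun a f n y =>
    iteratedFDeriv_const_smul_apply ((f.smooth n).contDiffAt)
  have key := temperedDistribution_integral_eq (μ := (volume : Measure (Ed d × Ed d)))
    (fun w => stftKernel φ ψ z w • tfShift φ w) (fun n => ?_) (fun k n => ?_) (c • tfShift ψ z)
    (fun y => ?_) u
  · simpa using key
  · simp only [hd]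
    exact (hkc.comp continuous_fst).smul (continuous_iteratedFDeriv_tfShift φ n)
  · obtain ⟨C, hC, h⟩ := exists_seminorm_tfShift_le φ hp k n
    have hcont : Continuous fun w : Ed d × Ed d =>
        ‖stftKernel φ ψ z w‖ * (C * Real.exp (‖w‖ ^ p)) :=
      hkc.norm.mul (continuous_const.mul
        (Real.continuous_exp.comp (continuous_norm.rpow_const fun _ => Or.inr hp.le)))
    refine ⟨_, hcont, ?_, fun w y => ?_⟩
    · refine ((integrable_exp_neg_norm_sub_rpow hp z).const_mul
        (C₂ * C * Real.exp (2 ^ p * ‖z‖ ^ p))).mono' hcont.aestronglyMeasurable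
        (ae_of_all _ fun w => ?_)
      rw [Real.norm_of_nonneg (by positivity)]
      have h3 : ‖w‖ ≤ ‖z‖ + ‖z - w‖ := by
        simpa using norm_sub_le z (z - w)
      have h4 := (Real.rpow_le_rpow (norm_nonneg _) h3 hp.le).trans
        (add_rpow_le_two_rpow_mul hp (norm_nonneg z) (norm_nonneg (z - w)))
      calc _ ≤ C₂ * Real.exp (-((2 ^ p + 1) * ‖z - w‖ ^ p)) * (C * Real.exp (‖w‖ ^ p)) := by
            gcongr
            exact h₂ z w
        _ = C₂ * C * Real.exp (-((2 ^ p + 1) * ‖z - w‖ ^ p) + ‖w‖ ^ p) := by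
            rw [Real.exp_add]; ring
        _ ≤ C₂ * C * Real.exp (2 ^ p * ‖z‖ ^ p + -(‖z - w‖ ^ p)) := by
            refine mul_le_mul_of_nonneg_left (Real.exp_le_exp.2 ?_) (by positivity)
            linarith
        _ = _ := by rw [Real.exp_add]; ring
    · rw [hd, norm_smul]
      have := h w y
      calc _ = ‖stftKernel φ ψ z w‖ * (‖y‖ ^ k * ‖iteratedFDeriv ℝ n (tfShift φ w) y‖) := by ring
        _ ≤ _ := by gcongr
  · exact (integral_stftKernel_mul_tfShift hp hC₁ h₁ z y).symm

end Reproducing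

theorem norm_le_pnorm {d : ℕ} (z : Ed d × Ed d) : ‖z‖ ≤ pnorm z := by
  rw [Prod.norm_def]
  refine max_le (Real.le_sqrt_of_sq_le ?_) (Real.le_sqrt_of_sq_le ?_)
  · linarith [sq_nonneg ‖z.2‖]
  · linarith [sq_nonneg ‖z.1‖]

theorem pnorm_le_two_mul_norm {d : ℕ} (z : Ed d × Ed d) : pnorm z ≤ 2 * ‖z‖ := by
  refine Real.sqrt_le_iff.2 ⟨by positivity, ?_⟩
  nlinarith [norm_fst_le z, norm_snd_le z, norm_nonneg z.1, norm_nonneg z.2]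

/-- A conic neighbourhood can be shrunk so that it is quantitatively separated from the
complement of the original one. -/
theorem IsConic.exists_separated_subcone {V : Type*} [NormedAddCommGroup V] [NormedSpace ℝ V]
    {Γ : Set V} (hΓo : IsOpen Γ) (hΓc : IsConic Γ) (hΓ0 : (0 : V) ∉ Γ) {z₀ : V} (hz₀ : z₀ ∈ Γ) :
    ∃ Γ' : Set V, IsOpen Γ' ∧ IsConic Γ' ∧ (0 : V) ∉ Γ' ∧ z₀ ∈ Γ' ∧
      ∃ δ : ℝ, 0 < δ ∧ ∀ z ∈ Γ', ∀ w ∉ Γ, δ * ‖z‖ ≤ ‖z - w‖ := by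
  obtain ⟨r, hr, hball⟩ := Metric.isOpen_iff.1 hΓo z₀ hz₀
  have hε : 0 < r / 2 := half_pos hr
  refine ⟨{z | ∃ t : ℝ, 0 < t ∧ ‖t • z - z₀‖ < r / 2}, ?_, ?_, ?_, ⟨1, one_pos, by simpa using hr⟩,
    r / 2 / (‖z₀‖ + r / 2), by positivity, ?_⟩
  · have : {z : V | ∃ t : ℝ, 0 < t ∧ ‖t • z - z₀‖ < r / 2} =
        ⋃ t : ℝ, ⋃ _ : 0 < t, {z | ‖t • z - z₀‖ < r / 2} := by
      ext z
      simp
    rw [this]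
    exact isOpen_iUnion fun t => isOpen_iUnion fun _ =>
      isOpen_lt ((continuous_const_smul t).sub continuous_const).norm continuous_const
  · rintro a ha z ⟨t, ht, hz⟩
    refine ⟨t / a, by positivity, ?_⟩
    rwa [smul_smul, div_mul_cancel₀ _ ha.ne']
  · rintro ⟨t, ht, hz⟩
    refine hΓ0 (hball ?_)
    rw [mem_ball_iff_norm]
    rw [smul_zero] at hz
    linarith
  · rintro z ⟨t, ht, hz⟩ w hw
    have htw : t • w ∉ Γ := fun h => hw <| by
      simpa [smul_smul, inv_mul_cancel₀ ht.ne'] using hΓc t⁻¹ (inv_pos.2 ht) _ h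
    have h1 : r ≤ ‖t • w - z₀‖ := by
      by_contra! h
      exact htw (hball (mem_ball_iff_norm.2 h))
    have h2 : ‖t • w - z₀‖ ≤ ‖t • z - z₀‖ + ‖t • z - t • w‖ := by
      have := norm_sub_le (t • z - z₀) (t • z - t • w)
      rwa [show t • z - z₀ - (t • z - t • w) = t • w - z₀ by abel] at this
    rw [← smul_sub, norm_smul, Real.norm_of_nonneg ht.le] at h2
    have h3 : t * ‖z‖ ≤ ‖z₀‖ + r / 2 := by
      have := norm_le_norm_sub_add (t • z) z₀
      rw [norm_smul, Real.norm_of_nonneg ht.le] at this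
      linarith
    rw [div_mul_eq_mul_div, div_le_iff₀ (by positivity)]
    refine le_of_mul_le_mul_left ?_ ht
    calc t * (r / 2 * ‖z‖) = r / 2 * (t * ‖z‖) := by ring
      _ ≤ (t * ‖z - w‖) * (‖z₀‖ + r / 2) :=
        mul_le_mul (by linarith) h3 (by positivity) (by positivity)
      _ = _ := by ring

/-- Rapid decay on a cone survives convolution-type averaging, on separated subcones. -/
theorem exists_kernel_mul_le {V : Type*} [NormedAddCommGroup V] {p δ A C₀ : ℝ} {Γ Γ' : Set V}
    {k : V → V → ℂ} {W : V → ℂ} (hp : 0 < p) (hδ : 0 < δ) (hA : 0 < A) (hC₀ : 0 ≤ C₀)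
    (hk : ∀ A : ℝ, 0 < A → ∃ C : ℝ, 0 ≤ C ∧ ∀ z w, ‖k z w‖ ≤ C * Real.exp (-(A * ‖z - w‖ ^ p)))
    (hW : ∀ w, ‖W w‖ ≤ C₀ * Real.exp (‖w‖ ^ p))
    (hΓ : ∀ A : ℝ, 0 < A → ∃ C : ℝ, 0 ≤ C ∧ ∀ w ∈ Γ, ‖W w‖ ≤ C * Real.exp (-(A * ‖w‖ ^ p)))
    (hsep : ∀ z ∈ Γ', ∀ w ∉ Γ, δ * ‖z‖ ≤ ‖z - w‖) :
    ∃ C : ℝ, 0 ≤ C ∧ ∀ z ∈ Γ', ∀ w, ‖k z w * W w‖ ≤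
      C * Real.exp (-(A * ‖z‖ ^ p)) * Real.exp (-(‖z - w‖ ^ p)) := by
  obtain ⟨C₁, hC₁, h₁⟩ := hk (A * 2 ^ p + 1) (by positivity)
  obtain ⟨C₂, hC₂, h₂⟩ := hΓ (A * 2 ^ p) (by positivity)
  obtain ⟨C₃, hC₃, h₃⟩ := hk (A * δ⁻¹ ^ p + (1 + δ⁻¹) ^ p + 1) (by positivity)
  refine ⟨C₁ * C₂ + C₃ * C₀, by positivity, fun z hz w => ?_⟩
  rw [norm_mul]
  by_cases hw : w ∈ Γ
  · have h4 : ‖z‖ ≤ ‖z - w‖ + ‖w‖ := norm_le_norm_sub_add z w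
    have h5 := mul_le_mul_of_nonneg_left ((Real.rpow_le_rpow (norm_nonneg _) h4 hp.le).trans
      (add_rpow_le_two_rpow_mul hp (norm_nonneg (z - w)) (norm_nonneg w))) hA.le
    calc _ ≤ (C₁ * Real.exp (-((A * 2 ^ p + 1) * ‖z - w‖ ^ p))) *
          (C₂ * Real.exp (-(A * 2 ^ p * ‖w‖ ^ p))) :=
          mul_le_mul (h₁ z w) (h₂ w hw) (norm_nonneg _) (by positivity)
      _ = (C₁ * C₂) * Real.exp (-((A * 2 ^ p + 1) * ‖z - w‖ ^ p) + -(A * 2 ^ p * ‖w‖ ^ p)) := by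
          rw [Real.exp_add]; ring
      _ ≤ (C₁ * C₂ + C₃ * C₀) * Real.exp (-(A * ‖z‖ ^ p) + -(‖z - w‖ ^ p)) :=
          mul_le_mul (le_add_of_nonneg_right (by positivity))
            (Real.exp_le_exp.2 (by linarith)) (Real.exp_pos _).le (by positivity)
      _ = _ := by rw [Real.exp_add]; ring
  · have h4 : ‖z‖ ≤ δ⁻¹ * ‖z - w‖ := by
      rw [inv_mul_eq_div, le_div_iff₀ hδ, mul_comm]
      exact hsep z hz w hw
    have h5 : ‖w‖ ≤ (1 + δ⁻¹) * ‖z - w‖ := by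
      have : ‖w‖ ≤ ‖z‖ + ‖z - w‖ := by simpa using norm_sub_le z (z - w)
      linarith
    have h6 := mul_le_mul_of_nonneg_left (Real.rpow_le_rpow (norm_nonneg _) h4 hp.le) hA.le
    have h7 := Real.rpow_le_rpow (norm_nonneg _) h5 hp.le
    rw [Real.mul_rpow (by positivity) (norm_nonneg _)] at h6 h7
    calc _ ≤ (C₃ * Real.exp (-((A * δ⁻¹ ^ p + (1 + δ⁻¹) ^ p + 1) * ‖z - w‖ ^ p))) *
          (C₀ * Real.exp (‖w‖ ^ p)) :=
          mul_le_mul (h₃ z w) (hW w) (norm_nonneg _) (by positivity)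
      _ = (C₃ * C₀) * Real.exp (-((A * δ⁻¹ ^ p + (1 + δ⁻¹) ^ p + 1) * ‖z - w‖ ^ p) +
          ‖w‖ ^ p) := by
          rw [Real.exp_add]; ring
      _ ≤ (C₁ * C₂ + C₃ * C₀) * Real.exp (-(A * ‖z‖ ^ p) + -(‖z - w‖ ^ p)) :=
          mul_le_mul (le_add_of_nonneg_left (by positivity))
            (Real.exp_le_exp.2 (by linarith)) (Real.exp_pos _).le (by positivity)
      _ = _ := by rw [Real.exp_add]; ring

end ChangeOfWindow

theorem statement7 (d : ℕ) (s : ℝ) (hs : 1/2 < s)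
    (u : TD d) (φ ψ : Ed d → ℂ)
    (hφ : φ ∈ SigmaGS s d) (hφ0 : φ ≠ 0) (hψ : ψ ∈ SigmaGS s d) (hψ0 : ψ ≠ 0)
    (Wφ Wψ : Ed d × Ed d → ℂ) (hWφ : IsSTFT u φ Wφ) (hWψ : IsSTFT u ψ Wψ)
    (z₀ : Ed d × Ed d) (hz₀ : z₀ ≠ 0)
    (Γ : Set (Ed d × Ed d)) (hΓo : IsOpen Γ) (hΓc : IsConic Γ)
    (hΓ0 : (0 : Ed d × Ed d) ∉ Γ) (hz₀Γ : z₀ ∈ Γ)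
    (hbd : ∀ A : ℝ, 0 < A → ∃ C : ℝ, ∀ z ∈ Γ, Real.exp (A * pnorm z ^ (1/s)) * ‖Wφ z‖ ≤ C) :
    ∃ Γ' : Set (Ed d × Ed d), IsOpen Γ' ∧ IsConic Γ' ∧ (0 : Ed d × Ed d) ∉ Γ' ∧ z₀ ∈ Γ' ∧
      ∀ A : ℝ, 0 < A → ∃ C : ℝ, ∀ z ∈ Γ', Real.exp (A * pnorm z ^ (1/s)) * ‖Wψ z‖ ≤ C := by
  have hd : 0 < d := by
    rcases Nat.eq_zero_or_pos d with rfl | h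
    · exact absurd (Subsingleton.elim _ _) hz₀
    · exact h
  have hs0 : 0 < s := by linarith
  have hp : 0 < 1 / s := one_div_pos.2 hs0
  obtain ⟨f, hf⟩ := SigmaGS.exists_schwartzMap hd hφ
  obtain ⟨g, hg⟩ := SigmaGS.exists_schwartzMap hd hψ
  have hWf : ∀ w, Wφ w = u (tfShift f w) := fun w =>
    hWφ w.1 w.2 _ fun y => by rw [tfShift_apply, hf]
  have hWg : ∀ w, Wψ w = u (tfShift g w) := fun w =>
    hWψ w.1 w.2 _ fun y => by rw [tfShift_apply, hg]
  obtain ⟨y₀, hy₀⟩ := Function.ne_iff.1 hφ0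
  have hc : (((2 * Real.pi) ^ d : ℝ) * ∫ v, (starRingEnd ℂ) (f v) * f v : ℂ) ≠ 0 :=
    mul_ne_zero (Complex.ofReal_ne_zero.2 (by positivity))
      (integral_conj_mul_self_ne_zero f (y₀ := y₀) (by rw [hf]; exact hy₀))
  set c : ℂ := ((2 * Real.pi) ^ d : ℝ) * ∫ v, (starRingEnd ℂ) (f v) * f v
  have hK : ∀ A : ℝ, 0 < A → ∃ C : ℝ, 0 ≤ C ∧ ∀ z w : Ed d × Ed d,
      ‖stftKernel f g z w‖ ≤ C * Real.exp (-(A * ‖z - w‖ ^ (1 / s))) := by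
    intro A hA
    obtain ⟨C, hC0, hC⟩ := exists_norm_FTgs_window_le hd hs0 hφ hψ hA
    refine ⟨C, hC0, fun z w => ?_⟩
    have h := hC (w.1 - z.1, z.2 - w.2)
    rw [norm_stftKernel]
    simp only [hf, hg]
    have hn : ‖(w.1 - z.1, z.2 - w.2)‖ = ‖z - w‖ := by
      rw [Prod.norm_def, Prod.norm_def, norm_sub_rev w.1]
      rfl
    rwa [hn] at h
  have hform : ∀ z, c * Wψ z = ∫ w, stftKernel f g z w * Wφ w := fun z => by
    rw [hWg]
    simp only [hWf]
    exact apply_tfShift_eq_integral hp hK u z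
  obtain ⟨C₀, hC₀, hgrow⟩ := exists_norm_apply_tfShift_le u f hp
  simp only [← hWf] at hgrow
  have hdecay : ∀ A : ℝ, 0 < A → ∃ C : ℝ, 0 ≤ C ∧
      ∀ w ∈ Γ, ‖Wφ w‖ ≤ C * Real.exp (-(A * ‖w‖ ^ (1 / s))) := by
    intro A hA
    obtain ⟨C, hC⟩ := hbd A hA
    refine ⟨C, le_trans (by positivity) (hC z₀ hz₀Γ), fun w hw => ?_⟩
    rw [Real.exp_neg, ← div_eq_mul_inv, le_div_iff₀' (Real.exp_pos _)]
    refine le_trans ?_ (hC w hw)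
    gcongr
    exact norm_le_pnorm w
  obtain ⟨Γ', hΓ'o, hΓ'c, hΓ'0, hz₀Γ', δ, hδ, hsep⟩ :=
    hΓc.exists_separated_subcone hΓo hΓ0 hz₀Γ
  refine ⟨Γ', hΓ'o, hΓ'c, hΓ'0, hz₀Γ', fun A hA => ?_⟩
  obtain ⟨C, hC0, hC⟩ := exists_kernel_mul_le (A := A * 2 ^ (1 / s)) hp hδ (by positivity) hC₀ hK
    hgrow hdecay hsep
  set J : ℝ := ∫ w : Ed d × Ed d, Real.exp (-(‖w‖ ^ (1 / s))) with hJ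
  refine ⟨C * J / ‖c‖, fun z hz => ?_⟩
  have hJz : ∫ w : Ed d × Ed d, Real.exp (-(‖z - w‖ ^ (1 / s))) = J := by
    have : (volume : Measure (Ed d × Ed d)).IsAddHaarMeasure := by
      rw [Measure.volume_eq_prod]
      infer_instance
    simp only [norm_sub_rev z]
    exact integral_sub_right_eq_self (fun w => Real.exp (-(‖w‖ ^ (1 / s)))) z
  have hbound : ‖c * Wψ z‖ ≤ C * Real.exp (-(A * 2 ^ (1 / s) * ‖z‖ ^ (1 / s))) * J := by
    rw [hform, ← hJz, ← integral_const_mul]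
    exact norm_integral_le_of_norm_le
      ((integrable_exp_neg_norm_sub_rpow hp z).const_mul _) (ae_of_all _ (hC z hz))
  rw [norm_mul] at hbound
  have hpn : A * pnorm z ^ (1 / s) ≤ A * 2 ^ (1 / s) * ‖z‖ ^ (1 / s) := by
    rw [mul_assoc, ← Real.mul_rpow two_pos.le (norm_nonneg z)]
    gcongr
    · exact Real.sqrt_nonneg _
    · exact pnorm_le_two_mul_norm z
  rw [le_div_iff₀ (norm_pos_iff.2 hc)]
  calc Real.exp (A * pnorm z ^ (1 / s)) * ‖Wψ z‖ * ‖c‖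
      ≤ Real.exp (A * 2 ^ (1 / s) * ‖z‖ ^ (1 / s)) * (‖c‖ * ‖Wψ z‖) := by
        rw [mul_assoc, mul_comm ‖Wψ z‖]
        gcongr
    _ ≤ Real.exp (A * 2 ^ (1 / s) * ‖z‖ ^ (1 / s)) *
        (C * Real.exp (-(A * 2 ^ (1 / s) * ‖z‖ ^ (1 / s))) * J) := by gcongr
    _ = C * J := by
        rw [Real.exp_neg]
        field_simp

end
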